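/- arXiv:2210.00027 — 2 statements merged into one kernel-verified Lean document; each statement's English description precedes it below -/
import Mathlib

section
/- For every p ∈ (1, ∞), the operator norm of 𝓗 on ℓ^p(ℤ) is at most the operator norm of 𝓚 on ℓ^p(ℤ); consequently cot(π/(2p*)) = ‖𝓗₀‖_p = ‖𝓗‖_p ≤ ‖𝓡‖_p = ‖𝓚‖_p, where p* = max{p, p/(p−1)}. -/
open scoped BigOperators
open MeasureTheory

noncomputable section

/-- The ℓ^p norm of a doubly infinite complex sequence. -/
def lpNorm (p : ℝ) (a : ℤ → ℂ) : ℝ := (∑' n : ℤ, ‖a n‖ ^ p) ^ (1 / p)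

/-- Membership in ℓ^p(ℤ). -/
def MemLpZ (p : ℝ) (a : ℤ → ℂ) : Prop := Summable fun n : ℤ => ‖a n‖ ^ p

/-- The operator norm of an operator on ℓ^p(ℤ): the least admissible constant. -/
def opNormOn (p : ℝ) (T : (ℤ → ℂ) → ℤ → ℂ) : ℝ :=
  sInf {C : ℝ | 0 ≤ C ∧ ∀ a : ℤ → ℂ, MemLpZ p a → lpNorm p (T a) ≤ C * lpNorm p a}

/-- The Riesz–Titchmarsh operator: 𝓡 a_n = (1/π) Σ_{m ∈ ℤ} a_{n-m}/(m + 1/2). -/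
def RT (a : ℤ → ℂ) (n : ℤ) : ℂ :=
  (1 / (Real.pi : ℂ)) * ∑' m : ℤ, a (n - m) / ((m : ℂ) + 1 / 2)

/-- The Kak–Hilbert transform: 𝓚 a_n = (2/π) Σ_{m odd} a_{n-m}/m. -/
def KT (a : ℤ → ℂ) (n : ℤ) : ℂ :=
  (2 / (Real.pi : ℂ)) * ∑' m : {m : ℤ // Odd m}, a (n - (m : ℤ)) / ((m : ℤ) : ℂ)

/-- The discrete Hilbert transform: 𝓗₀ a_n = (1/π) Σ_{m ≠ 0} a_{n-m}/m. -/
def H0T (a : ℤ → ℂ) (n : ℤ) : ℂ :=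
  (1 / (Real.pi : ℂ)) * ∑' m : {m : ℤ // m ≠ 0}, a (n - (m : ℤ)) / ((m : ℤ) : ℂ)

/-- The operator 𝓗: 𝓗 a_n = (2/π) Σ_{m even, m ≠ 0} a_{n-m}/m. -/
def HT (a : ℤ → ℂ) (n : ℤ) : ℂ :=
  (2 / (Real.pi : ℂ)) *
    ∑' m : {m : ℤ // Even (m : ℤ) ∧ (m : ℤ) ≠ 0}, a (n - (m : ℤ)) / ((m : ℤ) : ℂ)

/-- The operator 𝓘: 𝓘 a_n = (4/π²) Σ_{m odd} a_{n-m}/m². -/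
def IT (a : ℤ → ℂ) (n : ℤ) : ℂ :=
  (4 / (Real.pi : ℂ) ^ 2) * ∑' m : {m : ℤ // Odd m}, a (n - (m : ℤ)) / ((m : ℤ) : ℂ) ^ 2

/-- p* = max(p, p/(p-1)). -/
def pstar (p : ℝ) : ℝ := max p (p / (p - 1))

/-- C_p = cot(π/(2 p*)). -/
def Cconst (p : ℝ) : ℝ := Real.cot (Real.pi / (2 * pstar p))

lemma antitoneOn_sin_rpow_div_sin {c : ℝ} (hc : 0 < c) (hc1 : c ≤ 1) :
    AntitoneOn (fun θ : ℝ => Real.sin θ ^ c / Real.sin (c * θ)) (Set.Ioo 0 (Real.pi / 2)) := by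
  have hs : ∀ θ ∈ Set.Ioo 0 (Real.pi / 2), 0 < Real.sin θ ∧ 0 < Real.sin (c * θ) := by
    intro θ hθ
    refine ⟨Real.sin_pos_of_pos_of_lt_pi hθ.1 (by linarith [hθ.2, Real.pi_pos]),
      Real.sin_pos_of_pos_of_lt_pi (mul_pos hc hθ.1) ?_⟩
    nlinarith [hθ.2, Real.pi_pos, hθ.1]
  have hd : ∀ θ ∈ Set.Ioo 0 (Real.pi / 2),
      HasDerivAt (fun θ : ℝ => Real.sin θ ^ c / Real.sin (c * θ))
        ((Real.cos θ * c * Real.sin θ ^ (c - 1) * Real.sin (c * θ)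
          - Real.sin θ ^ c * (Real.cos (c * θ) * (c * 1))) / Real.sin (c * θ) ^ 2) θ := by
    intro θ hθ
    have h1 := (Real.hasDerivAt_sin θ).rpow_const (p := c) (Or.inl (hs θ hθ).1.ne')
    have h2 := ((hasDerivAt_id θ).const_mul c).sin
    exact h1.div h2 (hs θ hθ).2.ne'
  refine antitoneOn_of_deriv_nonpos (convex_Ioo _ _)
    (fun θ hθ => (hd θ hθ).continuousAt.continuousWithinAt) ?_ ?_
  · intro θ hθ
    rw [interior_Ioo] at hθ
    exact (hd θ hθ).differentiableAt.differentiableWithinAt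
  · intro θ hθ
    rw [interior_Ioo] at hθ
    rw [(hd θ hθ).deriv]
    refine div_nonpos_of_nonpos_of_nonneg ?_ (sq_nonneg _)
    have h3 : Real.sin θ ^ c = Real.sin θ ^ (c - 1) * Real.sin θ := by
      rw [← Real.rpow_add_one (hs θ hθ).1.ne']; ring_nf
    have h4 : Real.cos θ * c * Real.sin θ ^ (c - 1) * Real.sin (c * θ)
          - Real.sin θ ^ c * (Real.cos (c * θ) * (c * 1))
        = -(c * Real.sin θ ^ (c - 1) * Real.sin (θ - c * θ)) := by
      rw [h3, Real.sin_sub]; ring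
    rw [h4]
    have h5 : 0 ≤ Real.sin (θ - c * θ) :=
      Real.sin_nonneg_of_nonneg_of_le_pi (by nlinarith [hθ.1])
        (by nlinarith [hθ.1, hθ.2, Real.pi_pos, mul_pos hc hθ.1])
    have := Real.rpow_pos_of_pos (hs θ hθ).1 (c - 1)
    have := mul_nonneg (mul_nonneg hc.le this.le) h5
    linarith

lemma trig_pichorides {p : ℝ} (hp : 1 < p) (hp2 : p ≤ 2) {θ : ℝ} (h0 : 0 ≤ θ)
    (h1 : θ ≤ Real.pi / 2) :
    Real.sin θ ^ p ≤ Real.tan (Real.pi / (2 * p)) ^ p * Real.cos θ ^ p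
      - Real.sin (Real.pi / (2 * p)) ^ (p - 1) / Real.cos (Real.pi / (2 * p))
        * Real.cos (p * θ) := by
  have hpi := Real.pi_pos
  set t := Real.pi / (2 * p) with ht
  have hpt : p * t = Real.pi / 2 := by rw [ht]; field_simp
  have ht0 : 0 < t := by positivity
  have ht1 : t < Real.pi / 2 := by nlinarith
  have hst : 0 < Real.sin t := Real.sin_pos_of_pos_of_lt_pi ht0 (by linarith)
  have hct : 0 < Real.cos t := Real.cos_pos_of_mem_Ioo ⟨by linarith, ht1⟩
  set D := Real.sin t ^ (p - 1) / Real.cos t with hD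
  have hcond : Real.sin ((p - 1) * t) = Real.cos t := by
    rw [show (p - 1) * t = Real.pi / 2 - t by linarith, Real.sin_pi_div_two_sub]
  have hanti := antitoneOn_sin_rpow_div_sin (c := p - 1) (by linarith) (by linarith)
  set g : ℝ → ℝ := fun x => Real.tan x ^ p + D * (Real.cos (p * x) * Real.cos x ^ (-p)) with hg
  have hcos : ∀ x ∈ Set.Ico 0 (Real.pi / 2), 0 < Real.cos x := fun x hx =>
    Real.cos_pos_of_mem_Ioo ⟨by linarith [hx.1], hx.2⟩
  have hd : ∀ x ∈ Set.Ioo 0 (Real.pi / 2), HasDerivAt g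
      (p * Real.cos x ^ (-p - 1) * (Real.sin x ^ (p - 1) - D * Real.sin ((p - 1) * x))) x := by
    intro x hx
    have hc := hcos x ⟨hx.1.le, hx.2⟩
    have hs : 0 < Real.sin x := Real.sin_pos_of_pos_of_lt_pi hx.1 (by linarith [hx.2])
    have e1 := (Real.hasDerivAt_tan hc.ne').rpow_const (p := p)
      (Or.inl (Real.tan_pos_of_pos_of_lt_pi_div_two hx.1 hx.2).ne')
    have e2 := ((hasDerivAt_id x).const_mul p).cos
    have e3 := (Real.hasDerivAt_cos x).rpow_const (p := -p) (Or.inl hc.ne')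
    have e4 := e1.add ((e2.mul e3).const_mul D)
    refine HasDerivAt.congr_deriv (f := g) e4 ?_
    have k1 : Real.tan x ^ (p - 1) = Real.sin x ^ (p - 1) * Real.cos x ^ (-p - 1) * Real.cos x ^ 2 := by
      rw [Real.tan_eq_sin_div_cos, Real.div_rpow hs.le hc.le, div_eq_mul_inv, ← Real.rpow_neg hc.le,
        mul_assoc, ← Real.rpow_natCast, ← Real.rpow_add hc]
      congr 2; push_cast; ring
    have k2 : Real.cos x ^ (-p) = Real.cos x ^ (-p - 1) * Real.cos x := by
      rw [← Real.rpow_add_one hc.ne']; ring_nf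
    have k3 : Real.sin ((p - 1) * x)
        = Real.sin (p * x) * Real.cos x - Real.cos (p * x) * Real.sin x := by
      rw [← Real.sin_sub]; ring_nf
    simp only [id, k1, k2, k3]
    field_simp
    ring
  have hpos : ∀ x ∈ Set.Ioo 0 (Real.pi / 2), 0 < Real.sin ((p - 1) * x) := fun x hx =>
    Real.sin_pos_of_pos_of_lt_pi (mul_pos (by linarith) hx.1) (by nlinarith [hx.1, hx.2])
  have htm : t ∈ Set.Ioo 0 (Real.pi / 2) := ⟨ht0, ht1⟩
  have hRt : Real.sin t ^ (p - 1) / Real.sin ((p - 1) * t) = D := by rw [hcond]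
  have hcont : ContinuousOn g (Set.Ico 0 (Real.pi / 2)) := by
    intro x hx
    have hc := hcos x hx
    refine ContinuousAt.continuousWithinAt ?_
    refine ((Real.continuousAt_tan.2 hc.ne').rpow_const (Or.inr (by linarith))).add ?_
    refine continuousAt_const.mul (ContinuousAt.mul (by fun_prop) ?_)
    exact Real.continuous_cos.continuousAt.rpow_const (Or.inl hc.ne')
  have hgt : g t = Real.tan t ^ p := by
    simp [hg, hpt]
  have hle : ∀ x ∈ Set.Ico 0 (Real.pi / 2), g x ≤ g t := by
    intro x hx
    rcases le_total x t with hxt | hxt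
    · have hm : MonotoneOn g (Set.Icc 0 t) := by
        refine monotoneOn_of_deriv_nonneg (convex_Icc _ _)
          (hcont.mono fun y hy => ⟨hy.1, hy.2.trans_lt ht1⟩) ?_ ?_ <;>
        · intro y hy
          rw [interior_Icc] at hy
          have hy' : y ∈ Set.Ioo 0 (Real.pi / 2) := ⟨hy.1, hy.2.trans ht1⟩
          first
          | exact (hd y hy').differentiableAt.differentiableWithinAt
          | rw [(hd y hy').deriv]
            have := hanti hy' htm hy.2.le
            simp only [hRt] at this
            rw [le_div_iff₀ (hpos y hy')] at this
            have h6 := Real.rpow_pos_of_pos (hcos y ⟨hy.1.le, hy'.2⟩) (-p - 1)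
            exact mul_nonneg (by positivity) (by linarith)
      exact hm ⟨hx.1, hxt⟩ ⟨ht0.le, le_rfl⟩ hxt
    · have hm : AntitoneOn g (Set.Ico t (Real.pi / 2)) := by
        refine antitoneOn_of_deriv_nonpos (convex_Ico _ _)
          (hcont.mono fun y hy => ⟨ht0.le.trans hy.1, hy.2⟩) ?_ ?_ <;>
        · intro y hy
          rw [interior_Ico] at hy
          have hy' : y ∈ Set.Ioo 0 (Real.pi / 2) := ⟨ht0.trans hy.1, hy.2⟩
          first
          | exact (hd y hy').differentiableAt.differentiableWithinAt
          | rw [(hd y hy').deriv]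
            have := hanti htm hy' hy.1.le
            simp only [hRt] at this
            rw [div_le_iff₀ (hpos y hy')] at this
            have h6 := Real.rpow_pos_of_pos (hcos y ⟨hy'.1.le, hy'.2⟩) (-p - 1)
            exact mul_nonpos_of_nonneg_of_nonpos (by positivity) (by linarith)
      exact hm ⟨le_rfl, ht1⟩ ⟨hxt, hx.2⟩ hxt
  have hIco : ∀ x ∈ Set.Ico 0 (Real.pi / 2), Real.sin x ^ p ≤
      Real.tan t ^ p * Real.cos x ^ p - D * Real.cos (p * x) := by
    intro x hx
    have hc := hcos x hx
    have hs : 0 ≤ Real.sin x := Real.sin_nonneg_of_nonneg_of_le_pi hx.1 (by linarith [hx.2])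
    have h7 := hle x hx
    rw [hgt] at h7
    have hcp := Real.rpow_pos_of_pos hc p
    have h8 := mul_le_mul_of_nonneg_right h7 hcp.le
    simp only [hg] at h8
    rw [Real.tan_eq_sin_div_cos x, Real.div_rpow hs hc.le, Real.rpow_neg hc.le] at h8
    have h9 : (Real.sin x ^ p / Real.cos x ^ p + D * (Real.cos (p * x) * (Real.cos x ^ p)⁻¹))
        * Real.cos x ^ p = Real.sin x ^ p + D * Real.cos (p * x) := by
      field_simp
    linarith
  have hclos : θ ∈ closure (Set.Ico 0 (Real.pi / 2)) := by
    rw [closure_Ico (by positivity)]; exact ⟨h0, h1⟩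
  refine ContinuousWithinAt.closure_le hclos ?_ ?_ hIco
  · exact (Real.continuous_sin.rpow_const fun _ => Or.inr (by linarith)).continuousWithinAt
  · refine Continuous.continuousWithinAt ?_
    exact (continuous_const.mul (Real.continuous_cos.rpow_const fun _ => Or.inr (by linarith))).sub
      (by fun_prop)

/-- The function `Re ((|Re w| + i Im w) ^ p)`, subharmonic on the plane for `1 ≤ p ≤ 2`. -/
def pichoridesFun (p : ℝ) (w : ℂ) : ℝ := ((((|w.re| : ℝ) : ℂ) + w.im * Complex.I) ^ (p : ℂ)).re

lemma re_cpow_ofReal {p : ℝ} (hp : p ≠ 0) (z : ℂ) :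
    (z ^ (p : ℂ)).re = ‖z‖ ^ p * Real.cos (p * z.arg) := by
  rcases eq_or_ne z 0 with rfl | hz
  · simp [Complex.zero_cpow (Complex.ofReal_ne_zero.2 hp), Real.zero_rpow hp]
  · rw [Complex.cpow_def_of_ne_zero hz, Complex.exp_re, Complex.re_mul_ofReal,
      Complex.im_mul_ofReal, Complex.log_re, Complex.log_im,
      Real.rpow_def_of_pos (norm_pos_iff.2 hz), mul_comm z.arg]

lemma pichoridesFun_neg (p : ℝ) (w : ℂ) : pichoridesFun p (-w) = pichoridesFun p w := by
  rcases eq_or_ne p 0 with rfl | hp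
  · simp [pichoridesFun]
  have : (((|w.re| : ℝ) : ℂ) + ((-w).im : ℂ) * Complex.I)
      = (starRingEnd ℂ) (((|w.re| : ℝ) : ℂ) + w.im * Complex.I) := by
    simp
  unfold pichoridesFun
  rw [Complex.neg_re, abs_neg, this, re_cpow_ofReal hp, re_cpow_ofReal hp, Complex.norm_conj,
    Complex.arg_conj]
  split_ifs with h
  · rw [Complex.arg_eq_pi_iff] at h
    have h1 : (((|w.re| : ℝ) : ℂ) + w.im * Complex.I).re = |w.re| := by simp
    have h2 := abs_nonneg w.re
    linarith [h.1]
  · rw [mul_neg, Real.cos_neg]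

lemma pichoridesFun_of_re_nonneg (p : ℝ) {w : ℂ} (hw : 0 ≤ w.re) :
    pichoridesFun p w = (w ^ (p : ℂ)).re := by
  rw [pichoridesFun, abs_of_nonneg hw, Complex.re_add_im]

lemma pichoridesFun_abs_form {p : ℝ} (hp : p ≠ 0) (w : ℂ) :
    pichoridesFun p w
      = ‖w‖ ^ p * Real.cos (p * (((|w.re| : ℝ) : ℂ) + w.im * Complex.I).arg) := by
  have hn : ‖((|w.re| : ℝ) : ℂ) + w.im * Complex.I‖ = ‖w‖ := by
    rw [Complex.norm_def, Complex.norm_def, Complex.normSq_apply, Complex.normSq_apply]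
    simp
  rw [pichoridesFun, re_cpow_ofReal hp, hn]

lemma re_cpow_le_pichoridesFun {p : ℝ} (hp : 1 < p) (hp2 : p ≤ 2) (w : ℂ) :
    (w ^ (p : ℂ)).re ≤ pichoridesFun p w := by
  have hp0 : p ≠ 0 := by linarith
  rcases le_or_gt 0 w.re with hw | hw
  · rw [pichoridesFun_of_re_nonneg p hw]
  · rw [← pichoridesFun_neg, pichoridesFun_of_re_nonneg p (by simp; linarith),
      re_cpow_ofReal hp0, re_cpow_ofReal hp0, norm_neg]
    refine mul_le_mul_of_nonneg_left ?_ (by positivity)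
    have hpi := Real.pi_pos
    have key : ∀ x, Real.pi / 2 ≤ x → x ≤ Real.pi →
        Real.cos (p * x) ≤ Real.cos (p * (Real.pi - x)) := by
      intro x hx hx'
      have h1 := Real.cos_sub_cos (p * (Real.pi - x)) (p * x)
      have h2 : 0 ≤ Real.sin ((p * (Real.pi - x) + p * x) / 2) :=
        Real.sin_nonneg_of_nonneg_of_le_pi (by nlinarith) (by nlinarith)
      have h3 : Real.sin ((p * (Real.pi - x) - p * x) / 2) ≤ 0 :=
        Real.sin_nonpos_of_nonpos_of_neg_pi_le (by nlinarith) (by nlinarith)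
      nlinarith [mul_nonneg h2 (neg_nonneg.2 h3)]
    rcases lt_or_ge w.im 0 with him | him
    · rw [Complex.arg_neg_eq_arg_add_pi_of_im_neg him]
      have ha : w.arg < - (Real.pi / 2) := by
        by_contra! h
        rcases h.lt_or_eq with h | h
        · have := (Complex.abs_arg_lt_pi_div_two_iff (z := w)).1
            (abs_lt.2 ⟨h, by have := Complex.arg_neg_iff.2 him; linarith⟩)
          rcases this with this | this
          · linarith
          · simp [this] at hw
        · have := (Complex.arg_eq_neg_pi_div_two_iff).1 h.symm
          linarith [this.1]
      have := key (-w.arg) (by linarith) (by linarith [Complex.neg_pi_lt_arg w])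
      rw [mul_neg, Real.cos_neg] at this
      rwa [sub_neg_eq_add, add_comm Real.pi] at this
    · have ha : Real.pi / 2 < w.arg := by
        by_contra! h
        rcases h.lt_or_eq with h | h
        · have := (Complex.abs_arg_lt_pi_div_two_iff (z := w)).1
            (abs_lt.2 ⟨by have := Complex.arg_nonneg_iff.2 him; linarith, h⟩)
          rcases this with this | this
          · linarith
          · simp [this] at hw
        · have := (Complex.arg_eq_pi_div_two_iff).1 h
          linarith [this.1]
      have hk := key w.arg ha.le (Complex.arg_le_pi w)
      have hcos : Real.cos (p * (-w).arg) = Real.cos (p * (Real.pi - w.arg)) := by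
        rcases him.lt_or_eq with him | him
        · rw [Complex.arg_neg_eq_arg_sub_pi_of_im_pos him, ← Real.cos_neg]; ring_nf
        · have h1 : w.arg = Real.pi := Complex.arg_eq_pi_iff.2 ⟨hw, him.symm⟩
          have h2 : (-w).arg = 0 := Complex.arg_eq_zero_iff.2 ⟨by simp; linarith, by simp [← him]⟩
          rw [h1, h2, sub_self]
      rw [hcos]; exact hk

lemma continuous_pichoridesFun {p : ℝ} (hp : 0 < p) : Continuous (pichoridesFun p) := by
  refine Complex.continuous_re.comp ?_
  have hg : Continuous fun w : ℂ => (((|w.re| : ℝ) : ℂ) + w.im * Complex.I) := by fun_prop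
  rw [continuous_iff_continuousAt]
  intro w
  rcases eq_or_ne (((|w.re| : ℝ) : ℂ) + w.im * Complex.I) 0 with h | h
  · have := Complex.continuousAt_cpow_zero_of_re_pos (z := (p : ℂ)) (by simpa using hp)
    have h2 : ContinuousAt (fun w : ℂ => ((((|w.re| : ℝ) : ℂ) + w.im * Complex.I), (p : ℂ))) w :=
      hg.continuousAt.prodMk continuousAt_const
    exact ContinuousAt.comp_of_eq (g := fun x : ℂ × ℂ => x.1 ^ x.2) this h2 (by simp [h])
  · refine hg.continuousAt.cpow continuousAt_const ?_
    by_contra hs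
    rw [Complex.mem_slitPlane_iff, not_or, not_lt, not_not] at hs
    simp only [Complex.add_re, Complex.ofReal_re, Complex.mul_re, Complex.ofReal_im, Complex.I_re,
      Complex.I_im, Complex.add_im, Complex.mul_im] at hs
    have h0 := abs_nonneg w.re
    have h1 : |w.re| = 0 := le_antisymm (by linarith [hs.1]) h0
    have h2 : w.im = 0 := by linarith [hs.2]
    exact h (by simp [h1, h2])

lemma pichorides_pointwise {p : ℝ} (hp : 1 < p) (hp2 : p ≤ 2) :
    ∃ D : ℝ, 0 ≤ D ∧ ∀ w : ℂ, |w.im| ^ p ≤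
      Real.tan (Real.pi / (2 * p)) ^ p * |w.re| ^ p - D * pichoridesFun p w := by
  have hpi := Real.pi_pos
  have ht0 : 0 < Real.pi / (2 * p) := by positivity
  have ht1 : Real.pi / (2 * p) < Real.pi / 2 := by
    rw [div_lt_div_iff₀ (by positivity) (by positivity)]; nlinarith
  have hst : 0 < Real.sin (Real.pi / (2 * p)) :=
    Real.sin_pos_of_pos_of_lt_pi ht0 (by linarith)
  have hct : 0 < Real.cos (Real.pi / (2 * p)) := Real.cos_pos_of_mem_Ioo ⟨by linarith, ht1⟩
  refine ⟨Real.sin (Real.pi / (2 * p)) ^ (p - 1) / Real.cos (Real.pi / (2 * p)),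
    by positivity, fun w => ?_⟩
  rw [pichoridesFun_abs_form (by linarith)]
  set z : ℂ := ((|w.re| : ℝ) : ℂ) + w.im * Complex.I with hz
  have hzre : z.re = |w.re| := by simp [hz]
  have hzim : z.im = w.im := by simp [hz]
  have hn : ‖z‖ = ‖w‖ := by
    rw [Complex.norm_def, Complex.norm_def, Complex.normSq_apply, Complex.normSq_apply, hzre, hzim]
    simp
  have h1 : |w.re| = ‖w‖ * Real.cos |z.arg| := by
    rw [Real.cos_abs, ← hn, Complex.norm_mul_cos_arg, hzre]
  have harg : |z.arg| ≤ Real.pi / 2 := Complex.abs_arg_le_pi_div_two_iff.2 (by rw [hzre]; positivity)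
  have hsn : 0 ≤ Real.sin |z.arg| :=
    Real.sin_nonneg_of_nonneg_of_le_pi (abs_nonneg _) (by linarith)
  have hcn : 0 ≤ Real.cos |z.arg| := Real.cos_nonneg_of_mem_Icc ⟨by linarith [abs_nonneg z.arg], harg⟩
  have h2 : |w.im| = ‖w‖ * Real.sin |z.arg| := by
    rw [← hzim, ← Complex.norm_mul_sin_arg, abs_mul, hn, abs_norm]
    congr 1
    rcases abs_cases z.arg with h | h
    · rw [h.1] at hsn ⊢
      exact abs_of_nonneg hsn
    · rw [h.1, Real.sin_neg] at hsn ⊢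
      rw [← abs_neg, abs_of_nonneg hsn]
  have h3 : Real.cos (p * z.arg) = Real.cos (p * |z.arg|) := by
    rcases abs_cases z.arg with h | h
    · rw [h.1]
    · rw [h.1, mul_neg, Real.cos_neg]
  have key := trig_pichorides hp hp2 (abs_nonneg z.arg) harg
  rw [h1, h2, h3, Real.mul_rpow (norm_nonneg _) hsn, Real.mul_rpow (norm_nonneg _) hcn]
  have := mul_le_mul_of_nonneg_left key (Real.rpow_nonneg (norm_nonneg w) p)
  linarith

lemma exists_differentiable_re_approx {g : ℂ → ℝ} (hg : Continuous g) {ε : ℝ} (hε : 0 < ε) :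
    ∃ q : ℂ → ℂ, Differentiable ℂ q ∧ ∀ w : ℂ, ‖w‖ = 1 → |(q w).re - g w| ≤ ε := by
  have : Fact (0 < 2 * Real.pi) := ⟨by positivity⟩
  have hspan : ∀ T ∈ Submodule.span ℂ (Set.range (@fourier (2 * Real.pi))),
      ∃ q₁ q₂ : ℂ → ℂ, Differentiable ℂ q₁ ∧ Differentiable ℂ q₂ ∧
        ∀ t, T t = q₁ (AddCircle.toCircle t) + (starRingEnd ℂ) (q₂ (AddCircle.toCircle t)) := by
    intro T hT
    induction hT using Submodule.span_induction with
    | mem x hx =>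
      obtain ⟨n, rfl⟩ := hx
      obtain ⟨k, rfl | rfl⟩ := n.eq_nat_or_neg
      · refine ⟨fun z => z ^ k, 0, by fun_prop, by fun_prop, fun t => ?_⟩
        simp [fourier_apply, AddCircle.toCircle_nsmul]
      · refine ⟨0, fun z => z ^ k, by fun_prop, by fun_prop, fun t => ?_⟩
        rw [fourier_neg, fourier_apply]
        simp [AddCircle.toCircle_nsmul]
    | zero => exact ⟨0, 0, by fun_prop, by fun_prop, by simp⟩
    | add x y _ _ hx hy =>
      obtain ⟨a, b, ha, hb, hab⟩ := hx
      obtain ⟨c, d, hc, hd, hcd⟩ := hy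
      exact ⟨a + c, b + d, ha.add hc, hb.add hd, fun t => by simp [hab, hcd]; ring⟩
    | smul c x _ hx =>
      obtain ⟨a, b, ha, hb, hab⟩ := hx
      exact ⟨fun z => c * a z, fun z => (starRingEnd ℂ) c * b z, ha.const_mul _, hb.const_mul _,
        fun t => by simp [hab]; ring⟩
  let G : C(AddCircle (2 * Real.pi), ℂ) :=
    ⟨fun t => (g (AddCircle.toCircle t) : ℂ), by
      have := AddCircle.continuous_toCircle (T := 2 * Real.pi)
      fun_prop⟩
  have hG : G ∈ closure (Submodule.span ℂ (Set.range (@fourier (2 * Real.pi))) :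
      Set C(AddCircle (2 * Real.pi), ℂ)) := by
    rw [← Submodule.topologicalClosure_coe, span_fourier_closure_eq_top]; trivial
  obtain ⟨T, hT, hdist⟩ := Metric.mem_closure_iff.1 hG ε hε
  obtain ⟨q₁, q₂, h₁, h₂, h⟩ := hspan T hT
  refine ⟨fun z => q₁ z + q₂ z, h₁.add h₂, fun w hw => ?_⟩
  obtain ⟨t, ht⟩ := (AddCircle.homeomorphCircle (T := 2 * Real.pi) (by positivity)).surjective
    ⟨w, mem_sphere_zero_iff_norm.2 hw⟩
  have hw' : (AddCircle.toCircle t : ℂ) = w := by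
    rw [AddCircle.homeomorphCircle_apply] at ht
    rw [ht]
  have h3 : ‖T t - G t‖ ≤ ε := by
    rw [← dist_eq_norm, dist_comm]
    exact (ContinuousMap.dist_apply_le_dist t).trans hdist.le
  have h4 := (Complex.abs_re_le_norm _).trans h3
  have h5 : (T t - G t).re = (q₁ w + q₂ w).re - g w := by
    rw [h]; simp [G, hw']
  rwa [h5] at h4

lemma exists_norm_eq_one_max {p : ℝ} (hp : 1 < p) (hp2 : p ≤ 2) {F q : ℂ → ℂ}
    (hF : Differentiable ℂ F) (hq : Differentiable ℂ q) {δ : ℝ} (hδ : 0 < δ) :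
    ∃ w : ℂ, ‖w‖ = 1 ∧ ∀ z : ℂ, ‖z‖ ≤ 1 →
      ‖F z‖ ^ δ * Real.exp (pichoridesFun p (F z) - (q z).re)
        ≤ ‖F w‖ ^ δ * Real.exp (pichoridesFun p (F w) - (q w).re) := by
  set E : ℂ → ℝ := fun z => ‖F z‖ ^ δ * Real.exp (pichoridesFun p (F z) - (q z).re) with hE
  have hcg := continuous_pichoridesFun (p := p) (by linarith)
  have hFc := hF.continuous
  have hqc := hq.continuous
  have hEc : Continuous E := by
    refine Continuous.mul (hFc.norm.rpow_const fun _ => Or.inr hδ.le) ?_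
    exact Real.continuous_exp.comp ((hcg.comp hFc).sub (Complex.continuous_re.comp hqc))
  obtain ⟨z₀, hz₀, hmax⟩ := (isCompact_closedBall (0 : ℂ) 1).exists_isMaxOn
    ⟨0, by simp⟩ hEc.continuousOn
  rcases eq_or_lt_of_le (mem_closedBall_zero_iff.1 hz₀) with h1 | h1
  · exact ⟨z₀, h1, fun z hz => hmax (mem_closedBall_zero_iff.2 hz)⟩
  rcases eq_or_ne (E z₀) 0 with h0 | h0
  · refine ⟨1, by simp, fun z hz => ?_⟩
    have h2 : E z ≤ 0 := h0 ▸ hmax (mem_closedBall_zero_iff.2 hz)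
    exact h2.trans (by positivity)
  have hEnn : ∀ z, 0 ≤ E z := fun z => by positivity
  have hpos : 0 < E z₀ := lt_of_le_of_ne (hEnn _) (Ne.symm h0)
  -- near every interior maximum the function is constant
  have hopen : ∀ z ∈ Metric.ball (0 : ℂ) 1, E z = E z₀ → ∀ᶠ y in nhds z, E y = E z₀ := by
    intro z hz hzE
    have hFz : F z ≠ 0 := by
      intro h
      rw [hE] at hzE
      simp only [h, norm_zero, Real.zero_rpow hδ.ne', zero_mul] at hzE
      exact hpos.ne hzE
    obtain ⟨s, hs, hs'⟩ : ∃ s : ℂ, (s = 1 ∨ s = -1) ∧ 0 ≤ (s * F z).re := by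
      rcases le_total 0 (F z).re with h | h
      · exact ⟨1, Or.inl rfl, by simpa using h⟩
      · exact ⟨-1, Or.inr rfl, by simpa using h⟩
    have hsG : ∀ y, pichoridesFun p (s * F y) = pichoridesFun p (F y) := by
      intro y; rcases hs with rfl | rfl <;> simp [pichoridesFun_neg]
    have hsn : ∀ y, ‖s * F y‖ = ‖F y‖ := by
      intro y; rcases hs with rfl | rfl <;> simp
    have hslit : s * F z ∈ Complex.slitPlane := by
      rw [Complex.mem_slitPlane_iff]
      by_contra! hcon
      have h1 : (s * F z).re = 0 := le_antisymm hcon.1 hs'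
      have : s * F z = 0 := Complex.ext h1 hcon.2
      rcases hs with rfl | rfl <;> simp_all
    set f : ℂ → ℂ := fun y =>
      Complex.exp (δ * Complex.log (s * F y) + (s * F y) ^ (p : ℂ) - q y) with hf
    have hsl : ∀ᶠ y in nhds z, s * F y ∈ Complex.slitPlane :=
      (continuous_const.mul hFc).continuousAt.eventually (Complex.isOpen_slitPlane.mem_nhds hslit)
    have hfd : ∀ᶠ y in nhds z, DifferentiableAt ℂ f y := by
      filter_upwards [hsl] with y hy
      have e1 : DifferentiableAt ℂ (fun y => s * F y) y := (hF y).const_mul s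
      exact (((e1.clog hy).const_mul _).add (e1.cpow_const hy) |>.sub (hq y)).cexp
    have hfn : ∀ y, s * F y ∈ Complex.slitPlane →
        ‖f y‖ = ‖F y‖ ^ δ * Real.exp (((s * F y) ^ (p : ℂ)).re - (q y).re) := by
      intro y hy
      have h2 : 0 < ‖F y‖ := by
        rw [← hsn]; exact norm_pos_iff.2 (Complex.slitPlane_ne_zero hy)
      rw [hf, Complex.norm_exp, Complex.sub_re, Complex.add_re, Complex.re_ofReal_mul,
        Complex.log_re, hsn, Real.rpow_def_of_pos h2, ← Real.exp_add]
      ring_nf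
    have hle : ∀ y, s * F y ∈ Complex.slitPlane → ‖f y‖ ≤ E y := by
      intro y hy
      rw [hfn y hy, hE]
      have := re_cpow_le_pichoridesFun hp hp2 (s * F y)
      rw [hsG] at this
      exact mul_le_mul_of_nonneg_left (Real.exp_le_exp.2 (by linarith))
        (Real.rpow_nonneg (norm_nonneg _) _)
    have heq : ‖f z‖ = E z := by
      rw [hfn z hslit, ← pichoridesFun_of_re_nonneg p hs', hsG]
    have hball : ∀ᶠ y in nhds z, y ∈ Metric.ball (0 : ℂ) 1 := Metric.isOpen_ball.mem_nhds hz
    have hlm : IsLocalMax (norm ∘ f) z := by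
      filter_upwards [hsl, hball] with y hy hyb
      simp only [Function.comp]
      rw [heq, hzE]
      exact (hle y hy).trans (hmax (Metric.ball_subset_closedBall hyb))
    filter_upwards [Complex.eventually_eq_of_isLocalMax_norm hfd hlm, hsl, hball] with y h1 h2 h3
    refine le_antisymm (hmax (Metric.ball_subset_closedBall h3)) ?_
    rw [← hzE, ← heq, ← h1]
    exact hle y h2
  have hsub : Metric.ball (0 : ℂ) 1 ⊆ {z | E z = E z₀} := by
    have hpre := (convex_ball (0 : ℂ) 1).isPreconnected
    have ho : IsOpen {z | z ∈ Metric.ball (0 : ℂ) 1 ∧ E z = E z₀} := by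
      rw [isOpen_iff_mem_nhds]
      rintro z ⟨hz, hz'⟩
      exact Filter.inter_mem (Metric.isOpen_ball.mem_nhds hz) (hopen z hz hz')
    have hsub' := hpre.subset_of_closure_inter_subset ho
      ⟨z₀, mem_ball_zero_iff.2 h1, mem_ball_zero_iff.2 h1, rfl⟩ (by
        rintro z ⟨hz, hzb⟩
        refine ⟨hzb, ?_⟩
        have hcl : IsClosed {z | E z = E z₀} := isClosed_eq hEc continuous_const
        exact hcl.closure_subset_iff.2 (fun y hy => hy.2) hz)
    exact fun z hz => (hsub' hz).2
  have hone : E 1 = E z₀ := by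
    have hcl : IsClosed {z | E z = E z₀} := isClosed_eq hEc continuous_const
    have h2 : (1 : ℂ) ∈ closure (Metric.ball (0 : ℂ) 1) := by
      rw [closure_ball _ one_ne_zero]; simp
    exact hcl.closure_subset_iff.2 hsub h2
  refine ⟨1, by simp, fun z hz => ?_⟩
  have h2 : E z ≤ E z₀ := hmax (mem_closedBall_zero_iff.2 hz)
  exact h2.trans hone.ge

lemma integral_pichoridesFun_nonneg_of_ne_zero {p : ℝ} (hp : 1 < p) (hp2 : p ≤ 2) {F : ℂ → ℂ}
    (hF : Differentiable ℂ F) {x : ℝ} (hx : x ≠ 0) (h0 : F 0 = x) :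
    0 ≤ ∫ t in (0 : ℝ)..2 * Real.pi, pichoridesFun p (F (circleMap 0 1 t)) := by
  have hcg := continuous_pichoridesFun (p := p) (by linarith)
  have hFc := hF.continuous
  have hgF : Continuous fun z => pichoridesFun p (F z) := hcg.comp hFc
  have hg0 : 0 ≤ pichoridesFun p (F 0) := by
    rw [pichoridesFun_abs_form (by linarith), h0]
    simp only [Complex.ofReal_re, Complex.ofReal_im, Complex.ofReal_zero, zero_mul, add_zero]
    rw [Complex.arg_ofReal_of_nonneg (abs_nonneg x)]
    simp only [mul_zero, Real.cos_zero, mul_one]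
    positivity
  have key : ∀ ε > 0, -(2 * ε) * (2 * Real.pi)
      ≤ ∫ t in (0 : ℝ)..2 * Real.pi, pichoridesFun p (F (circleMap 0 1 t)) := by
    intro ε hε
    obtain ⟨q, hq, hqε⟩ := exists_differentiable_re_approx hgF hε
    obtain ⟨L, hL⟩ := (isCompact_sphere (0 : ℂ) 1).exists_bound_of_continuousOn hFc.continuousOn
    have hL1 : 0 < max L 1 := by positivity
    have hb : ∀ δ : ℝ, 0 < δ → ‖F 0‖ ^ δ * Real.exp (pichoridesFun p (F 0) - (q 0).re)
        ≤ (max L 1) ^ δ * Real.exp ε := by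
      intro δ hδ
      obtain ⟨w, hw, hmax⟩ := exists_norm_eq_one_max hp hp2 hF hq hδ
      refine (hmax 0 (by simp)).trans ?_
      have h1 : ‖F w‖ ≤ max L 1 := (hL w (by simpa using hw)).trans (le_max_left _ _)
      have h2 := (abs_le.1 (hqε w hw)).1
      have h3 : pichoridesFun p (F w) - (q w).re ≤ ε := by linarith
      gcongr
    have hlim : Real.exp (pichoridesFun p (F 0) - (q 0).re) ≤ Real.exp ε := by
      have t1 : Filter.Tendsto (fun δ : ℝ => ‖F 0‖ ^ δ *
          Real.exp (pichoridesFun p (F 0) - (q 0).re)) (nhdsWithin 0 (Set.Ioi 0))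
          (nhds (‖F 0‖ ^ (0 : ℝ) * Real.exp (pichoridesFun p (F 0) - (q 0).re))) := by
        refine Filter.Tendsto.mono_left ?_ nhdsWithin_le_nhds
        refine Filter.Tendsto.mul_const _ ?_
        have hne : ‖F 0‖ ≠ 0 := by rw [h0]; simpa using hx
        exact (Real.continuousAt_const_rpow hne)
      have t2 : Filter.Tendsto (fun δ : ℝ => (max L 1) ^ δ * Real.exp ε)
          (nhdsWithin 0 (Set.Ioi 0)) (nhds ((max L 1) ^ (0 : ℝ) * Real.exp ε)) := by
        refine Filter.Tendsto.mono_left ?_ nhdsWithin_le_nhds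
        exact Filter.Tendsto.mul_const _ (Real.continuousAt_const_rpow hL1.ne')
      have := le_of_tendsto_of_tendsto t1 t2
        (eventually_nhdsWithin_of_forall fun δ hδ => hb δ hδ)
      simpa using this
    have h4 : pichoridesFun p (F 0) - (q 0).re ≤ ε := Real.exp_le_exp.1 hlim
    have h5 : ∫ t in (0 : ℝ)..2 * Real.pi, (q (circleMap 0 1 t)).re
        = 2 * Real.pi * (q 0).re := by
      have hm := DiffContOnCl.circleAverage (f := q) (c := 0) (R := 1) hq.diffContOnCl
      rw [Real.circleAverage_def] at hm
      have hi : IntervalIntegrable (fun t => q (circleMap 0 1 t)) volume 0 (2 * Real.pi) :=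
        (hq.continuous.comp (continuous_circleMap 0 1)).intervalIntegrable _ _
      have h6 := Complex.reCLM.intervalIntegral_comp_comm hi
      simp only [Complex.reCLM_apply] at h6
      rw [h6, ← hm, Complex.smul_re, smul_eq_mul]
      have := Real.pi_pos
      field_simp
    have h6 : ∫ t in (0 : ℝ)..2 * Real.pi, ((q (circleMap 0 1 t)).re - ε)
        ≤ ∫ t in (0 : ℝ)..2 * Real.pi, pichoridesFun p (F (circleMap 0 1 t)) := by
      have hc1 : Continuous fun t => (q (circleMap 0 1 t)).re :=
        Complex.continuous_re.comp (hq.continuous.comp (continuous_circleMap 0 1))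
      refine intervalIntegral.integral_mono_on (by positivity)
        ((hc1.sub continuous_const).intervalIntegrable _ _)
        ((hgF.comp (continuous_circleMap 0 1)).intervalIntegrable _ _) fun t _ => ?_
      have := (abs_le.1 (hqε (circleMap 0 1 t) (by simp))).2
      linarith
    rw [intervalIntegral.integral_sub, h5, intervalIntegral.integral_const] at h6
    · simp only [sub_zero, smul_eq_mul] at h6
      have := Real.pi_pos
      nlinarith
    · exact (Complex.continuous_re.comp
        (hq.continuous.comp (continuous_circleMap 0 1))).intervalIntegrable _ _
    · exact intervalIntegrable_const
  by_contra! hneg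
  have hpi := Real.pi_pos
  have := key (-(∫ t in (0 : ℝ)..2 * Real.pi, pichoridesFun p (F (circleMap 0 1 t)))
    / (8 * Real.pi)) (by apply div_pos <;> linarith)
  have h7 : -(2 * (-(∫ t in (0 : ℝ)..2 * Real.pi, pichoridesFun p (F (circleMap 0 1 t)))
    / (8 * Real.pi))) * (2 * Real.pi)
      = (∫ t in (0 : ℝ)..2 * Real.pi, pichoridesFun p (F (circleMap 0 1 t))) / 2 := by
    field_simp; ring
  rw [h7] at this
  linarith

lemma integral_pichoridesFun_nonneg {p : ℝ} (hp : 1 < p) (hp2 : p ≤ 2) {F : ℂ → ℂ}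
    (hF : Differentiable ℂ F) {x : ℝ} (h0 : F 0 = x) :
    0 ≤ ∫ t in (0 : ℝ)..2 * Real.pi, pichoridesFun p (F (circleMap 0 1 t)) := by
  have hcg := continuous_pichoridesFun (p := p) (by linarith)
  have hFc := hF.continuous
  have hcont : Continuous fun η : ℝ =>
      ∫ t in (0 : ℝ)..2 * Real.pi, pichoridesFun p (F (circleMap 0 1 t) + η) := by
    apply intervalIntegral.continuous_parametric_intervalIntegral_of_continuous'
    have := continuous_circleMap 0 1
    simp only [Function.uncurry_def]
    fun_prop
  have hev : ∀ᶠ η : ℝ in nhdsWithin 0 {0}ᶜ, 0 ≤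
      ∫ t in (0 : ℝ)..2 * Real.pi, pichoridesFun p (F (circleMap 0 1 t) + η) := by
    have h1 : ∀ᶠ η : ℝ in nhdsWithin 0 {0}ᶜ, x + η ≠ 0 := by
      rcases eq_or_ne x 0 with rfl | hx
      · filter_upwards [self_mem_nhdsWithin] with η hη
        simpa using hη
      · refine nhdsWithin_le_nhds ?_
        have : Filter.Tendsto (fun η : ℝ => x + η) (nhds 0) (nhds (x + 0)) :=
          (continuous_const.add continuous_id).tendsto 0
        exact this.eventually_ne (by simpa using hx)
    filter_upwards [h1] with η hη
    exact integral_pichoridesFun_nonneg_of_ne_zero hp hp2 (F := fun z => F z + η)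
      (hF.add_const _) hη (by simp [h0])
  have ht : Filter.Tendsto (fun η : ℝ =>
      ∫ t in (0 : ℝ)..2 * Real.pi, pichoridesFun p (F (circleMap 0 1 t) + η))
      (nhdsWithin 0 {0}ᶜ) (nhds (∫ t in (0 : ℝ)..2 * Real.pi,
        pichoridesFun p (F (circleMap 0 1 t) + ((0 : ℝ) : ℂ)))) :=
    (hcont.tendsto 0).mono_left nhdsWithin_le_nhds
  have := ge_of_tendsto ht hev
  simpa using this

lemma mul_rpow_sub_one_mul_le {p x y : ℝ} (hp : 1 < p) (hx : 0 ≤ x) (hy : 0 ≤ y) :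
    p * x ^ (p - 1) * y ≤ (p - 1) * x ^ p + y ^ p := by
  have hp0 : 0 < p := by linarith
  have hp1 : 0 < p - 1 := by linarith
  have h := Real.young_inequality_of_nonneg hy (Real.rpow_nonneg hx (p - 1))
    (Real.HolderConjugate.conjExponent hp)
  rw [← Real.rpow_mul hx] at h
  have e1 : (p - 1) * Real.conjExponent p = p := by
    rw [Real.conjExponent]; field_simp
  rw [e1, Real.conjExponent] at h
  have h2 := mul_le_mul_of_nonneg_left h hp0.le
  have e2 : p * (y ^ p / p + x ^ p / (p / (p - 1))) = (p - 1) * x ^ p + y ^ p := by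
    field_simp; ring
  rw [e2] at h2
  linarith

lemma sum_rpow_abs_average_le {p : ℝ} (hp : 1 < p) {n : ℕ} {φ : ℕ → ℝ → ℝ} {A κ T : ℝ}
    (hκ : 0 < κ) (hT : 0 ≤ T) (hA : 0 ≤ A)
    (hc : ∀ j, Continuous (φ j)) (h0 : ∀ j t, 0 ≤ φ j t)
    (h1 : ∀ t, ∑ j ∈ Finset.range n, φ j t = 1)
    (hφκ : ∀ j, ∫ t in (0 : ℝ)..T, φ j t = κ) (a : ℕ → ℝ) {g : ℝ → ℝ} (hg : Continuous g)
    (hgf : ∫ t in (0 : ℝ)..T, |g t| ^ p ≤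
      A * ∫ t in (0 : ℝ)..T, |∑ j ∈ Finset.range n, a j * φ j t| ^ p) :
    ∑ m ∈ Finset.range n, |κ⁻¹ * ∫ t in (0 : ℝ)..T, g t * φ m t| ^ p ≤
      A * ∑ j ∈ Finset.range n, |a j| ^ p := by
  have hp0 : 0 < p := by linarith
  have hgp : Continuous fun t => |g t| ^ p := hg.abs.rpow_const fun _ => Or.inr hp0.le
  have hgi : ∀ m, IntervalIntegrable (fun t => |g t| ^ p * φ m t) volume 0 T :=
    fun m => (hgp.mul (hc m)).intervalIntegrable _ _
  have hf : ∫ t in (0 : ℝ)..T, |∑ j ∈ Finset.range n, a j * φ j t| ^ p ≤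
      κ * ∑ j ∈ Finset.range n, |a j| ^ p := by
    calc _ ≤ ∫ t in (0 : ℝ)..T, ∑ j ∈ Finset.range n, |a j| ^ p * φ j t := by
          refine intervalIntegral.integral_mono_on hT ?_ ?_ fun t _ => ?_
          · refine Continuous.intervalIntegrable ?_ _ _
            exact (continuous_finsetSum _ fun j _ => (hc j).const_mul _).abs.rpow_const
              fun _ => Or.inr hp0.le
          · exact (continuous_finsetSum _ fun j _ => (hc j).const_mul _).intervalIntegrable _ _
          · have h2 := Real.rpow_arith_mean_le_arith_mean_rpow (Finset.range n)
              (fun j => φ j t) (fun j => |a j|) (fun j _ => h0 j t) (h1 t)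
              (fun j _ => abs_nonneg _) hp.le
            calc |∑ j ∈ Finset.range n, a j * φ j t| ^ p
                ≤ (∑ j ∈ Finset.range n, φ j t * |a j|) ^ p := by
                  refine Real.rpow_le_rpow (abs_nonneg _) ?_ hp0.le
                  refine (Finset.abs_sum_le_sum_abs _ _).trans_eq ?_
                  refine Finset.sum_congr rfl fun j _ => ?_
                  rw [abs_mul, abs_of_nonneg (h0 j t), mul_comm]
              _ ≤ _ := h2
              _ = _ := Finset.sum_congr rfl fun j _ => mul_comm _ _
      _ = _ := by
          rw [intervalIntegral.integral_finsetSum fun j _ =>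
            ((hc j).const_mul _).intervalIntegrable _ _, Finset.mul_sum]
          refine Finset.sum_congr rfl fun j _ => ?_
          rw [intervalIntegral.integral_const_mul, hφκ j, mul_comm]
  have hb : ∀ m, |κ⁻¹ * ∫ t in (0 : ℝ)..T, g t * φ m t| ^ p ≤
      κ⁻¹ * ∫ t in (0 : ℝ)..T, |g t| ^ p * φ m t := by
    intro m
    set b := |κ⁻¹ * ∫ t in (0 : ℝ)..T, g t * φ m t| with hbdef
    have hb0 : 0 ≤ b := abs_nonneg _
    have hb1 : b ≤ κ⁻¹ * ∫ t in (0 : ℝ)..T, |g t| * φ m t := by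
      rw [hbdef, abs_mul, abs_of_pos (inv_pos.2 hκ)]
      refine mul_le_mul_of_nonneg_left ?_ (inv_pos.2 hκ).le
      refine (intervalIntegral.abs_integral_le_integral_abs hT).trans_eq ?_
      refine intervalIntegral.integral_congr fun t _ => ?_
      simp only [abs_mul, abs_of_nonneg (h0 m t)]
    have hy : p * b ^ (p - 1) * ∫ t in (0 : ℝ)..T, |g t| * φ m t ≤
        (p - 1) * b ^ p * κ + ∫ t in (0 : ℝ)..T, |g t| ^ p * φ m t := by
      rw [← hφκ m, ← intervalIntegral.integral_const_mul, ← intervalIntegral.integral_const_mul,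
        ← intervalIntegral.integral_add (((hc m).const_mul _).intervalIntegrable _ _) (hgi m)]
      refine intervalIntegral.integral_mono_on hT
        (((hg.abs.mul (hc m)).const_mul _).intervalIntegrable _ _)
        ((((hc m).const_mul _).add (hgp.mul (hc m))).intervalIntegrable _ _) fun t _ => ?_
      have := mul_le_mul_of_nonneg_right (mul_rpow_sub_one_mul_le hp hb0 (abs_nonneg (g t)))
        (h0 m t)
      nlinarith
    have hbp : b ^ p = b ^ (p - 1) * b := by
      rcases hb0.eq_or_lt with h | h
      · rw [← h, Real.zero_rpow hp0.ne', mul_zero]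
      · rw [← Real.rpow_add_one h.ne']; ring_nf
    have h3 : p * b ^ (p - 1) * b ≤ p * b ^ (p - 1) * (κ⁻¹ * ∫ t in (0 : ℝ)..T, |g t| * φ m t) :=
      mul_le_mul_of_nonneg_left hb1 (mul_nonneg hp0.le (Real.rpow_nonneg hb0 _))
    have h4 := mul_le_mul_of_nonneg_left hy (inv_pos.2 hκ).le
    have h5 : κ⁻¹ * ((p - 1) * b ^ p * κ) = (p - 1) * b ^ p := by field_simp
    rw [mul_add, h5] at h4
    nlinarith
  calc _ ≤ ∑ m ∈ Finset.range n, κ⁻¹ * ∫ t in (0 : ℝ)..T, |g t| ^ p * φ m t :=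
        Finset.sum_le_sum fun m _ => hb m
    _ = κ⁻¹ * ∫ t in (0 : ℝ)..T, |g t| ^ p := by
        rw [← Finset.mul_sum, ← intervalIntegral.integral_finsetSum fun j _ => hgi j]
        simp only [← Finset.mul_sum, h1, mul_one]
    _ ≤ κ⁻¹ * (A * (κ * ∑ j ∈ Finset.range n, |a j| ^ p)) := by
        refine mul_le_mul_of_nonneg_left (hgf.trans ?_) (inv_pos.2 hκ).le
        exact mul_le_mul_of_nonneg_left hf hA
    _ = _ := by field_simp

lemma fejer_nonneg (n : ℕ) (t : ℝ) :
    0 ≤ 2 * ∑ k ∈ Finset.range n, ((n : ℝ) - k) * Real.cos (k * t) - n := by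
  have key : 2 * ∑ k ∈ Finset.range n, ((n : ℝ) - k) * Real.cos (k * t) - n =
      (∑ k ∈ Finset.range n, Real.cos (k * t)) ^ 2 +
      (∑ k ∈ Finset.range n, Real.sin (k * t)) ^ 2 := by
    induction n with
    | zero => simp
    | succ n ih =>
      have e1 : ∑ k ∈ Finset.range (n + 1), (((n + 1 : ℕ) : ℝ) - k) * Real.cos (k * t) =
          ∑ k ∈ Finset.range n, ((n : ℝ) - k) * Real.cos (k * t) +
            ∑ k ∈ Finset.range (n + 1), Real.cos (k * t) := by
        rw [Finset.sum_range_succ, Finset.sum_range_succ, ← add_assoc, ← Finset.sum_add_distrib]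
        push_cast
        congr 1
        · exact Finset.sum_congr rfl fun k _ => by ring
        · ring
      have e2 : ∑ k ∈ Finset.range (n + 1), Real.cos (k * t) =
          1 + ∑ k ∈ Finset.range n, Real.cos ((n - k : ℝ) * t) := by
        rw [← Finset.sum_range_reflect, Finset.sum_range_succ, add_comm]
        congr 1
        · simp
        · refine Finset.sum_congr rfl fun k hk => ?_
          have : k ≤ n := (Finset.mem_range.1 hk).le
          congr 2
          rw [show n + 1 - 1 - k = n - k by omega]
          push_cast [this]; ring
      have e3 : ∑ k ∈ Finset.range n, Real.cos ((n - k : ℝ) * t) =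
          Real.cos (n * t) * ∑ k ∈ Finset.range n, Real.cos (k * t) +
          Real.sin (n * t) * ∑ k ∈ Finset.range n, Real.sin (k * t) := by
        rw [Finset.mul_sum, Finset.mul_sum, ← Finset.sum_add_distrib]
        refine Finset.sum_congr rfl fun k _ => ?_
        rw [sub_mul, Real.cos_sub]
      rw [e3] at e2
      rw [e1]
      rw [Finset.sum_range_succ] at e2 ⊢
      rw [Finset.sum_range_succ (fun k : ℕ => Real.sin (k * t))]
      have := Real.sin_sq_add_cos_sq (n * t)
      push_cast
      linear_combination ih + 2 * e2 - this
  rw [key]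
  positivity

lemma sum_cos_sub_two_pi_div {n k : ℕ} (hk : 0 < k) (hkn : k < n) (t : ℝ) :
    ∑ j ∈ Finset.range n, Real.cos (k * (t - 2 * Real.pi * j / n)) = 0 := by
  have hn : n ≠ 0 := by omega
  have hζ := Complex.isPrimitiveRoot_exp n hn
  set ζ := Complex.exp (2 * Real.pi * Complex.I / n) with hζd
  have hsum : ∑ j ∈ Finset.range n, (ζ⁻¹ ^ k) ^ j = 0 := by
    have h1 : ζ⁻¹ ^ k ≠ 1 := (hζ.inv).pow_ne_one_of_pos_of_lt hk.ne' hkn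
    rw [geom_sum_eq h1, ← pow_mul, mul_comm, pow_mul, (hζ.inv).pow_eq_one]
    simp
  have h2 := congrArg (fun z => (Complex.exp (k * t * Complex.I) * z).re) hsum
  simp only [mul_zero, Complex.zero_re, Finset.mul_sum, Complex.re_sum] at h2
  rw [← h2]
  refine Finset.sum_congr rfl fun j _ => ?_
  rw [← Complex.exp_ofReal_mul_I_re, hζd, ← Complex.exp_neg, ← Complex.exp_nat_mul,
    ← Complex.exp_nat_mul, ← Complex.exp_add]
  congr 2
  push_cast
  field_simp
  ring

lemma integral_cos_nat_mul_sub {k : ℕ} (hk : k ≠ 0) (α : ℝ) :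
    ∫ t in (0 : ℝ)..2 * Real.pi, Real.cos (k * (t - α)) = 0 := by
  have hk' : (k : ℝ) ≠ 0 := by exact_mod_cast hk
  simp only [mul_sub]
  rw [intervalIntegral.integral_comp_mul_sub _ hk', integral_cos]
  have : (k : ℝ) * (2 * Real.pi) - k * α = -(k * α) + k * (2 * Real.pi) := by ring
  rw [this, Real.sin_add_nat_mul_two_pi]
  simp

lemma integral_sin_int_mul_sub (k : ℤ) (hk : k ≠ 0) (α : ℝ) :
    ∫ t in (0 : ℝ)..2 * Real.pi, Real.sin (k * t - α) = 0 := by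
  have hk' : (k : ℝ) ≠ 0 := by exact_mod_cast hk
  rw [intervalIntegral.integral_comp_mul_sub _ hk', integral_sin]
  have : (k : ℝ) * (2 * Real.pi) - α = -α + k * (2 * Real.pi) := by ring
  rw [this, Real.cos_add_int_mul_two_pi]
  simp

lemma integral_sin_mul_cos (k l : ℕ) (α β : ℝ) :
    ∫ t in (0 : ℝ)..2 * Real.pi, Real.sin (k * (t - α)) * Real.cos (l * (t - β)) =
      if k = l then Real.pi * Real.sin (k * (β - α)) else 0 := by
  have hc : ∀ t : ℝ, Real.sin (k * (t - α)) * Real.cos (l * (t - β)) =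
      2⁻¹ * (Real.sin (((k + l : ℤ) : ℝ) * t - (k * α + l * β)) +
        Real.sin (((k - l : ℤ) : ℝ) * t - (k * α - l * β))) := by
    intro t
    have e1 : ((k + l : ℤ) : ℝ) * t - (k * α + l * β) = k * (t - α) + l * (t - β) := by
      push_cast; ring
    have e2 : ((k - l : ℤ) : ℝ) * t - (k * α - l * β) = k * (t - α) - l * (t - β) := by
      push_cast; ring
    rw [e1, e2, Real.sin_add, Real.sin_sub]
    ring
  simp only [hc]
  rw [intervalIntegral.integral_const_mul, intervalIntegral.integral_add
    (Continuous.intervalIntegrable (by fun_prop) _ _)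
    (Continuous.intervalIntegrable (by fun_prop) _ _)]
  rcases eq_or_ne k l with rfl | hkl
  · rcases eq_or_ne k 0 with rfl | hk
    · simp
    · rw [integral_sin_int_mul_sub _ (by omega)]
      simp only [if_true, sub_self, Int.cast_zero, zero_mul, zero_sub, zero_add]
      rw [intervalIntegral.integral_const, smul_eq_mul,
        show -((k : ℝ) * α - k * β) = k * (β - α) by ring]
      ring
  · rw [integral_sin_int_mul_sub _ (by omega), integral_sin_int_mul_sub _ (by omega), if_neg hkl]
    simp

/-- The Fejér kernel with `n` terms, normalised so that its translates by multiples of `2π / n`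
sum to one. -/
def fejerKernel (n : ℕ) (t : ℝ) : ℝ :=
  (2 * ∑ k ∈ Finset.range n, ((n : ℝ) - k) * Real.cos (k * t) - n) / n ^ 2

/-- The harmonic conjugate of the Fejér kernel. -/
def conjFejerKernel (n : ℕ) (t : ℝ) : ℝ :=
  (2 * ∑ k ∈ Finset.range n, ((n : ℝ) - k) * Real.sin (k * t)) / n ^ 2

/-- The kernel of a convolution on `ℤ / n` approximating the discrete Hilbert transform. -/
def cyclicKernel (n : ℕ) (d : ℝ) : ℝ :=
  2 / n ^ 3 * ∑ k ∈ Finset.range n, ((n : ℝ) - k) ^ 2 * Real.sin (k * (2 * Real.pi * d / n))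

lemma continuous_fejerKernel (n : ℕ) : Continuous (fejerKernel n) := by
  unfold fejerKernel; fun_prop

lemma continuous_conjFejerKernel (n : ℕ) : Continuous (conjFejerKernel n) := by
  unfold conjFejerKernel; fun_prop

lemma fejerKernel_nonneg (n : ℕ) (t : ℝ) : 0 ≤ fejerKernel n t :=
  div_nonneg (fejer_nonneg n t) (by positivity)

lemma sum_fejerKernel {n : ℕ} (hn : 0 < n) (t : ℝ) :
    ∑ j ∈ Finset.range n, fejerKernel n (t - 2 * Real.pi * j / n) = 1 := by
  have hn' : (n : ℝ) ≠ 0 := by positivity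
  unfold fejerKernel
  rw [← Finset.sum_div, Finset.sum_sub_distrib, ← Finset.mul_sum, Finset.sum_comm]
  have : ∀ k ∈ Finset.range n, k ≠ 0 → ∑ j ∈ Finset.range n,
      ((n : ℝ) - k) * Real.cos (k * (t - 2 * Real.pi * j / n)) = 0 := by
    intro k hk hk0
    rw [← Finset.mul_sum, sum_cos_sub_two_pi_div (Nat.pos_of_ne_zero hk0) (Finset.mem_range.1 hk),
      mul_zero]
  rw [Finset.sum_eq_single 0 this (fun h => absurd (Finset.mem_range.2 hn) h)]
  simp
  field_simp
  ring

lemma integral_fejerKernel {n : ℕ} (hn : 0 < n) (α : ℝ) :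
    ∫ t in (0 : ℝ)..2 * Real.pi, fejerKernel n (t - α) = 2 * Real.pi / n := by
  have hn' : (n : ℝ) ≠ 0 := by positivity
  unfold fejerKernel
  rw [intervalIntegral.integral_div, intervalIntegral.integral_sub
    (Continuous.intervalIntegrable (by fun_prop) _ _)
    (Continuous.intervalIntegrable (by fun_prop) _ _),
    intervalIntegral.integral_const_mul, intervalIntegral.integral_finsetSum fun k _ =>
      Continuous.intervalIntegrable (by fun_prop) _ _]
  have : ∀ k ∈ Finset.range n, k ≠ 0 →
      ∫ t in (0 : ℝ)..2 * Real.pi, ((n : ℝ) - k) * Real.cos (k * (t - α)) = 0 := by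
    intro k _ hk0
    rw [intervalIntegral.integral_const_mul, integral_cos_nat_mul_sub hk0, mul_zero]
  rw [Finset.sum_eq_single 0 this (fun h => absurd (Finset.mem_range.2 hn) h)]
  simp
  field_simp
  ring

lemma integral_conjFejerKernel_mul_fejerKernel (n : ℕ) (α β : ℝ) :
    ∫ t in (0 : ℝ)..2 * Real.pi, conjFejerKernel n (t - α) * fejerKernel n (t - β) =
      4 * Real.pi / n ^ 4 *
        ∑ k ∈ Finset.range n, ((n : ℝ) - k) ^ 2 * Real.sin (k * (β - α)) := by
  rcases Nat.eq_zero_or_pos n with rfl | hn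
  · simp [conjFejerKernel]
  have hn' : (n : ℝ) ≠ 0 := by positivity
  have h0 : ∀ t, conjFejerKernel n (t - α) * fejerKernel n (t - β) =
      4 / n ^ 4 * ∑ k ∈ Finset.range n, ∑ l ∈ Finset.range n, (((n : ℝ) - k) * ((n : ℝ) - l)) *
        (Real.sin (k * (t - α)) * Real.cos (l * (t - β))) -
      2 / n ^ 3 * ∑ k ∈ Finset.range n, ((n : ℝ) - k) *
        (Real.sin (k * (t - α)) * Real.cos ((0 : ℕ) * (t - β))) := by
    intro t
    have e : ∑ k ∈ Finset.range n, ∑ l ∈ Finset.range n, (((n : ℝ) - k) * ((n : ℝ) - l)) *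
        (Real.sin (k * (t - α)) * Real.cos (l * (t - β))) =
        (∑ k ∈ Finset.range n, ((n : ℝ) - k) * Real.sin (k * (t - α))) *
        ∑ l ∈ Finset.range n, ((n : ℝ) - l) * Real.cos (l * (t - β)) := by
      rw [Finset.sum_mul_sum]
      exact Finset.sum_congr rfl fun k _ => Finset.sum_congr rfl fun l _ => by ring
    rw [e]
    simp only [Nat.cast_zero, zero_mul, Real.cos_zero, mul_one]
    unfold conjFejerKernel fejerKernel
    generalize ∑ k ∈ Finset.range n, ((n : ℝ) - k) * Real.sin (k * (t - α)) = x
    generalize ∑ l ∈ Finset.range n, ((n : ℝ) - l) * Real.cos (l * (t - β)) = y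
    field_simp
    ring
  simp only [h0]
  rw [intervalIntegral.integral_sub (Continuous.intervalIntegrable (by fun_prop) _ _)
    (Continuous.intervalIntegrable (by fun_prop) _ _), intervalIntegral.integral_const_mul,
    intervalIntegral.integral_const_mul, intervalIntegral.integral_finsetSum fun k _ =>
      Continuous.intervalIntegrable (by fun_prop) _ _, intervalIntegral.integral_finsetSum
      fun k _ => Continuous.intervalIntegrable (by fun_prop) _ _]
  have h1 : ∀ k ∈ Finset.range n, ∫ t in (0 : ℝ)..2 * Real.pi, ((n : ℝ) - k) *
        (Real.sin (k * (t - α)) * Real.cos ((0 : ℕ) * (t - β))) = 0 := by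
    intro k _
    rw [intervalIntegral.integral_const_mul, integral_sin_mul_cos]
    split_ifs with h
    · simp [h]
    · simp
  have h2 : ∀ k ∈ Finset.range n, ∫ t in (0 : ℝ)..2 * Real.pi, ∑ l ∈ Finset.range n,
      (((n : ℝ) - k) * ((n : ℝ) - l)) * (Real.sin (k * (t - α)) * Real.cos (l * (t - β))) =
      Real.pi * (((n : ℝ) - k) ^ 2 * Real.sin (k * (β - α))) := by
    intro k hk
    rw [intervalIntegral.integral_finsetSum fun k _ =>
      Continuous.intervalIntegrable (by fun_prop) _ _]
    simp only [intervalIntegral.integral_const_mul, integral_sin_mul_cos, mul_ite, mul_zero]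
    rw [Finset.sum_ite_eq, if_pos hk]
    ring
  rw [Finset.sum_eq_zero h1, Finset.sum_congr rfl h2, ← Finset.mul_sum]
  ring

/-- The discrete form of the conjugate function inequality of Pichorides on `ℤ / n`. -/
theorem sum_rpow_cyclicKernel_le {p : ℝ} (hp : 1 < p) (hp2 : p ≤ 2) {n : ℕ} (hn : 0 < n)
    (a : ℕ → ℝ) :
    ∑ m ∈ Finset.range n, |∑ j ∈ Finset.range n, a j * cyclicKernel n ((m : ℝ) - j)| ^ p ≤
      Real.tan (Real.pi / (2 * p)) ^ p * ∑ j ∈ Finset.range n, |a j| ^ p := by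
  have hn' : (n : ℝ) ≠ 0 := by positivity
  have hp0 : 0 < p := by linarith
  have htan : 0 ≤ Real.tan (Real.pi / (2 * p)) := by
    refine Real.tan_nonneg_of_nonneg_of_le_pi_div_two (by positivity) ?_
    exact div_le_div_of_nonneg_left Real.pi_pos.le (by norm_num) (by linarith)
  let τ : ℕ → ℝ := fun j => 2 * Real.pi * j / n
  let φ : ℕ → ℝ → ℝ := fun j t => fejerKernel n (t - τ j)
  let g : ℝ → ℝ := fun t => ∑ j ∈ Finset.range n, a j * conjFejerKernel n (t - τ j)
  have hφc : ∀ j, Continuous (φ j) := fun j =>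
    (continuous_fejerKernel n).comp (continuous_id.sub continuous_const)
  have hgc' : ∀ j, Continuous fun t => conjFejerKernel n (t - τ j) := fun j =>
    (continuous_conjFejerKernel n).comp (continuous_id.sub continuous_const)
  have hg : Continuous g := continuous_finsetSum _ fun j _ => (hgc' j).const_mul _
  have hf : Continuous fun t => ∑ j ∈ Finset.range n, a j * φ j t :=
    continuous_finsetSum _ fun j _ => (hφc j).const_mul _
  let F : ℂ → ℂ := fun z => ∑ j ∈ Finset.range n, (a j : ℂ) *
    ((2 * ∑ k ∈ Finset.range n, ((n : ℂ) - k) * (z * Complex.exp (-(τ j * Complex.I))) ^ k - n) /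
      n ^ 2)
  have hF : Differentiable ℂ F := by
    intro z
    fun_prop
  have hF0 : F 0 = ((∑ j ∈ Finset.range n, a j * (1 / n) : ℝ) : ℂ) := by
    simp only [F, zero_mul]
    push_cast
    refine Finset.sum_congr rfl fun j _ => ?_
    rw [Finset.sum_eq_single 0 (fun k _ hk => by simp [hk])
      (fun h => absurd (Finset.mem_range.2 hn) h)]
    have : (n : ℂ) ≠ 0 := by exact_mod_cast hn.ne'
    simp
    field_simp
    ring_nf
    simp
  have hpow : ∀ (j k : ℕ) (t : ℝ), (circleMap 0 1 t * Complex.exp (-(τ j * Complex.I))) ^ k =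
      Complex.exp (((k * (t - τ j) : ℝ) : ℂ) * Complex.I) := by
    intro j k t
    simp only [circleMap, Complex.ofReal_one, one_mul, zero_add]
    rw [← Complex.exp_add, ← Complex.exp_nat_mul]
    congr 1
    push_cast
    ring
  have hFt : ∀ t, F (circleMap 0 1 t) =
      ((∑ j ∈ Finset.range n, a j * φ j t : ℝ) : ℂ) + (g t : ℂ) * Complex.I := by
    intro t
    simp only [F, φ, g, hpow, fejerKernel, conjFejerKernel]
    push_cast
    rw [Finset.sum_mul, ← Finset.sum_add_distrib]
    refine Finset.sum_congr rfl fun j _ => ?_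
    simp only [Complex.exp_mul_I, mul_add, Finset.sum_add_distrib, ← mul_assoc, ← Finset.sum_mul]
    ring
  obtain ⟨D, hD, hDw⟩ := pichorides_pointwise hp hp2
  have hB := integral_pichoridesFun_nonneg hp hp2 hF hF0
  have hpc : Continuous fun t => pichoridesFun p (F (circleMap 0 1 t)) :=
    (continuous_pichoridesFun (by linarith)).comp (hF.continuous.comp (continuous_circleMap 0 1))
  have hgf : ∫ t in (0 : ℝ)..2 * Real.pi, |g t| ^ p ≤ Real.tan (Real.pi / (2 * p)) ^ p *
      ∫ t in (0 : ℝ)..2 * Real.pi, |∑ j ∈ Finset.range n, a j * φ j t| ^ p := by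
    have hfp : Continuous fun t => |∑ j ∈ Finset.range n, a j * φ j t| ^ p :=
      hf.abs.rpow_const fun _ => Or.inr hp0.le
    have hgp : Continuous fun t => |g t| ^ p := hg.abs.rpow_const fun _ => Or.inr hp0.le
    calc _ ≤ ∫ t in (0 : ℝ)..2 * Real.pi, (Real.tan (Real.pi / (2 * p)) ^ p *
            |∑ j ∈ Finset.range n, a j * φ j t| ^ p -
            D * pichoridesFun p (F (circleMap 0 1 t))) := by
          refine intervalIntegral.integral_mono_on (by positivity)
            (hgp.intervalIntegrable _ _)
            (((hfp.const_mul _).sub (hpc.const_mul _)).intervalIntegrable _ _) fun t _ => ?_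
          have := hDw (F (circleMap 0 1 t))
          have e1 : (F (circleMap 0 1 t)).re = ∑ j ∈ Finset.range n, a j * φ j t := by
            rw [hFt]; simp
          have e2 : (F (circleMap 0 1 t)).im = g t := by rw [hFt]; simp
          rwa [e1, e2] at this
      _ = _ := by
          rw [intervalIntegral.integral_sub ((hfp.const_mul _).intervalIntegrable _ _)
            ((hpc.const_mul _).intervalIntegrable _ _), intervalIntegral.integral_const_mul,
            intervalIntegral.integral_const_mul]
      _ ≤ _ := sub_le_self _ (mul_nonneg hD hB)
  have hκ : 0 < 2 * Real.pi / n := by positivity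
  have main := sum_rpow_abs_average_le hp hκ (by positivity) (Real.rpow_nonneg htan p) hφc
    (fun j t => fejerKernel_nonneg n _) (sum_fejerKernel hn) (fun j => integral_fejerKernel hn _)
    a hg hgf
  refine le_trans (le_of_eq ?_) main
  refine Finset.sum_congr rfl fun m _ => ?_
  congr 2
  have e : ∀ t, g t * φ m t =
      ∑ j ∈ Finset.range n, a j * (conjFejerKernel n (t - τ j) * φ m t) := by
    intro t
    simp only [g, Finset.sum_mul, mul_assoc]
  have hi : ∀ j, IntervalIntegrable (fun t => a j * (conjFejerKernel n (t - τ j) * φ m t)) volume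
      0 (2 * Real.pi) := fun j => (((hgc' j).mul (hφc m)).const_mul _).intervalIntegrable _ _
  simp only [e]
  rw [intervalIntegral.integral_finsetSum fun j _ => hi j, Finset.mul_sum]
  refine Finset.sum_congr rfl fun j _ => ?_
  rw [intervalIntegral.integral_const_mul]
  simp only [φ]
  rw [integral_conjFejerKernel_mul_fejerKernel, cyclicKernel]
  have e3 : 2 * Real.pi * ((m : ℝ) - j) / n = τ m - τ j := by simp only [τ]; ring
  rw [e3]
  generalize ∑ k ∈ Finset.range n, ((n : ℝ) - k) ^ 2 * Real.sin (k * (τ m - τ j)) = x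
  field_simp
  ring

lemma sum_sq_sub_mul_pow {ζ : ℂ} (hζ : ζ ≠ 1) (n : ℕ) :
    ∑ k ∈ Finset.range n, ((n : ℂ) - k) ^ 2 * ζ ^ k =
      n ^ 2 / (1 - ζ) - 2 * n * ζ / (1 - ζ) ^ 2 + ζ * (1 + ζ) / (1 - ζ) ^ 3 * (1 - ζ ^ n) := by
  have h : 1 - ζ ≠ 0 := sub_ne_zero.2 hζ.symm
  induction n with
  | zero => simp
  | succ n ih =>
    rw [Finset.sum_range_succ']
    have e : ∑ k ∈ Finset.range n, (((n + 1 : ℕ) : ℂ) - ((k + 1 : ℕ) : ℂ)) ^ 2 * ζ ^ (k + 1) =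
        ζ * ∑ k ∈ Finset.range n, ((n : ℂ) - k) ^ 2 * ζ ^ k := by
      rw [Finset.mul_sum]
      refine Finset.sum_congr rfl fun k _ => ?_
      push_cast
      ring
    rw [e, ih]
    push_cast
    field_simp
    ring

lemma tendsto_nat_mul_exp_div_sub_one (z : ℂ) :
    Filter.Tendsto (fun n : ℕ => (n : ℂ) * (Complex.exp (z / n) - 1)) Filter.atTop (nhds z) := by
  have h1 : HasDerivAt (fun x : ℂ => Complex.exp (z * x)) z 0 := by
    have := ((hasDerivAt_id (0 : ℂ)).const_mul z).cexp
    simpa using this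
  have h2 := h1.tendsto_slope_zero
  have h3 : Filter.Tendsto (fun n : ℕ => ((n : ℂ))⁻¹) Filter.atTop (nhdsWithin 0 {0}ᶜ) := by
    refine tendsto_nhdsWithin_iff.2 ⟨tendsto_inv_atTop_nhds_zero_nat, ?_⟩
    filter_upwards [Filter.eventually_gt_atTop 0] with n hn
    simp [hn.ne']
  refine (h2.comp h3).congr fun n => ?_
  simp [div_eq_mul_inv]

lemma tendsto_cyclicKernel (d : ℤ) :
    Filter.Tendsto (fun n : ℕ => cyclicKernel n d) Filter.atTop (nhds (Real.pi * d)⁻¹) := by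
  rcases eq_or_ne d 0 with rfl | hd
  · simp [cyclicKernel]
  set z : ℂ := 2 * Real.pi * Complex.I * d with hz
  have hπ : (Real.pi : ℂ) ≠ 0 := by exact_mod_cast Real.pi_ne_zero
  have hd' : (d : ℂ) ≠ 0 := by exact_mod_cast hd
  have hz0 : z ≠ 0 := by simp [hz, hπ, hd']
  have hlim := tendsto_nat_mul_exp_div_sub_one z
  have hζ1 : Filter.Tendsto (fun n : ℕ => Complex.exp (z / n)) Filter.atTop (nhds 1) := by
    have := (tendsto_const_div_atTop_nhds_zero_nat z).cexp
    simpa using this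
  have hT : Filter.Tendsto (fun n : ℕ => -(2 / ((n : ℂ) * (Complex.exp (z / n) - 1))) -
      4 * Complex.exp (z / n) / ((n : ℂ) * (Complex.exp (z / n) - 1)) ^ 2) Filter.atTop
      (nhds (-(2 / z) - 4 * 1 / z ^ 2)) :=
    ((tendsto_const_nhds.div hlim hz0).neg).sub
      ((hζ1.const_mul 4).div (hlim.pow 2) (pow_ne_zero 2 hz0))
  have hval : (-(2 / z) - 4 * 1 / z ^ 2).im = (Real.pi * d)⁻¹ := by
    have e : -(2 / z) - 4 * 1 / z ^ 2 =
        (((1 / (Real.pi * d) ^ 2 : ℝ)) : ℂ) + (((Real.pi * d)⁻¹ : ℝ) : ℂ) * Complex.I := by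
      rw [hz]
      push_cast
      have := Complex.I_sq
      field_simp
      linear_combination (-4 * (Real.pi : ℂ) * d * Complex.I - 4) * this
    rw [e, Complex.add_im, Complex.ofReal_im, Complex.im_ofReal_mul, Complex.I_im, mul_one, zero_add]
  have him := (Complex.continuous_im.tendsto _).comp hT
  rw [hval] at him
  refine him.congr' ?_
  have hne : ∀ᶠ n : ℕ in Filter.atTop, (n : ℂ) * (Complex.exp (z / n) - 1) ≠ 0 :=
    hlim.eventually_ne hz0
  filter_upwards [hne, Filter.eventually_gt_atTop 0] with n h hn
  have hn' : (n : ℂ) ≠ 0 := by exact_mod_cast hn.ne'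
  have hζ : Complex.exp (z / n) ≠ 1 := fun h' => h (by simp [h'])
  have hpow : Complex.exp (z / n) ^ n = 1 := by
    rw [← Complex.exp_nat_mul, mul_div_cancel₀ _ hn', hz, mul_comm, Complex.exp_int_mul_two_pi_mul_I]
  have hs := sum_sq_sub_mul_pow hζ n
  rw [hpow, sub_self, mul_zero, add_zero] at hs
  have hK : cyclicKernel n d = ((2 / n ^ 3 : ℝ) * ∑ k ∈ Finset.range n,
      ((n : ℂ) - k) ^ 2 * Complex.exp (z / n) ^ k).im := by
    rw [Complex.im_ofReal_mul, Complex.im_sum, cyclicKernel]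
    congr 1
    refine Finset.sum_congr rfl fun k _ => ?_
    have e1 : ((n : ℂ) - k) ^ 2 = ((((n : ℝ) - k) ^ 2 : ℝ) : ℂ) := by push_cast; ring
    have e2 : (k : ℂ) * (z / n) = ((k * (2 * Real.pi * d / n) : ℝ) : ℂ) * Complex.I := by
      rw [hz]; push_cast; ring
    rw [e1, Complex.im_ofReal_mul, ← Complex.exp_nat_mul, e2, Complex.exp_ofReal_mul_I_im]
  rw [hK, hs]
  simp only [Function.comp]
  congr 1
  have h1 : Complex.exp (z / n) - 1 ≠ 0 := sub_ne_zero.2 hζ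
  have h2 : 1 - Complex.exp (z / n) ≠ 0 := sub_ne_zero.2 hζ.symm
  generalize Complex.exp (z / n) = ζ at *
  have h3 : (1 - ζ) = -(ζ - 1) := by ring
  rw [h3]
  push_cast
  field_simp
  ring

lemma sum_rpow_hilbert_range_le {p : ℝ} (hp : 1 < p) (hp2 : p ≤ 2) (r : ℕ) (a : ℕ → ℝ) :
    ∑ i ∈ Finset.range r, |∑ j ∈ Finset.range r, a j * (Real.pi * ((i - j : ℤ) : ℝ))⁻¹| ^ p ≤
      Real.tan (Real.pi / (2 * p)) ^ p * ∑ j ∈ Finset.range r, |a j| ^ p := by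
  have hp0 : 0 < p := by linarith
  have hlim : Filter.Tendsto (fun n : ℕ => ∑ i ∈ Finset.range r,
      |∑ j ∈ Finset.range r, a j * cyclicKernel n ((i - j : ℤ) : ℝ)| ^ p) Filter.atTop
      (nhds (∑ i ∈ Finset.range r,
        |∑ j ∈ Finset.range r, a j * (Real.pi * ((i - j : ℤ) : ℝ))⁻¹| ^ p)) := by
    refine tendsto_finsetSum _ fun i _ => Filter.Tendsto.rpow_const ?_ (Or.inr hp0.le)
    refine (tendsto_finsetSum _ fun j _ => ?_).abs
    exact (tendsto_cyclicKernel _).const_mul _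
  refine le_of_tendsto hlim ?_
  filter_upwards [Filter.eventually_ge_atTop (r + 1)] with n hn
  have hsub : Finset.range r ⊆ Finset.range n := Finset.range_subset_range.2 (by omega)
  have h := sum_rpow_cyclicKernel_le hp hp2 (n := n) (by omega) fun j => if j < r then a j else 0
  have e1 : ∀ x : ℕ → ℝ, ∑ j ∈ Finset.range n, (if j < r then a j else 0) * x j =
      ∑ j ∈ Finset.range r, a j * x j := by
    intro x
    rw [← Finset.sum_subset hsub]
    · exact Finset.sum_congr rfl fun j hj => by rw [if_pos (Finset.mem_range.1 hj)]
    · intro j _ hj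
      rw [if_neg (fun h => hj (Finset.mem_range.2 h)), zero_mul]
  have e2 : ∑ j ∈ Finset.range n, |if j < r then a j else 0| ^ p =
      ∑ j ∈ Finset.range r, |a j| ^ p := by
    rw [← Finset.sum_subset hsub]
    · exact Finset.sum_congr rfl fun j hj => by rw [if_pos (Finset.mem_range.1 hj)]
    · intro j _ hj
      rw [if_neg (fun h => hj (Finset.mem_range.2 h)), abs_zero, Real.zero_rpow hp0.ne']
  simp only [e1] at h
  rw [e2] at h
  refine le_trans ?_ h
  push_cast
  exact Finset.sum_le_sum_of_subset_of_nonneg hsub fun i _ _ => Real.rpow_nonneg (abs_nonneg _) _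

lemma sum_rpow_hilbert_le_of_le_two {p : ℝ} (hp : 1 < p) (hp2 : p ≤ 2) (S : Finset ℤ) (a : ℤ → ℝ) :
    ∑ i ∈ S, |∑ j ∈ S, a j * (Real.pi * ((i - j : ℤ) : ℝ))⁻¹| ^ p ≤
      Real.tan (Real.pi / (2 * p)) ^ p * ∑ j ∈ S, |a j| ^ p := by
  have hp0 : 0 < p := by linarith
  obtain ⟨M, hM⟩ : ∃ M : ℕ, ∀ i ∈ S, i.natAbs < M :=
    ⟨S.sup Int.natAbs + 1, fun i hi => Nat.lt_succ_of_le (Finset.le_sup hi)⟩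
  let e : ℕ → ℤ := fun j => (j : ℤ) - M
  have he : Function.Injective e := fun i j h => by simpa [e] using h
  have hsub : S ⊆ (Finset.range (2 * M)).image e := by
    intro i hi
    have := hM i hi
    refine Finset.mem_image.2 ⟨(i + M).toNat, ?_, ?_⟩
    · rw [Finset.mem_range]; omega
    · simp only [e]; omega
  have hsum : ∀ f : ℤ → ℝ, (∀ i, i ∉ S → f i = 0) →
      ∑ j ∈ Finset.range (2 * M), f (e j) = ∑ j ∈ S, f j := by
    intro f hf
    rw [← Finset.sum_image (fun x _ y _ h => he h) (f := f)]
    exact (Finset.sum_subset hsub fun i _ h => hf i h).symm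
  have h := sum_rpow_hilbert_range_le hp hp2 (2 * M) fun j => if e j ∈ S then a (e j) else 0
  have e1 : ∀ i : ℕ, ∑ j ∈ Finset.range (2 * M), (if e j ∈ S then a (e j) else 0) *
      (Real.pi * ((i - j : ℤ) : ℝ))⁻¹ = ∑ j ∈ S, a j * (Real.pi * ((e i - j : ℤ) : ℝ))⁻¹ := by
    intro i
    have := hsum (fun j => (if j ∈ S then a j else 0) * (Real.pi * ((e i - j : ℤ) : ℝ))⁻¹)
      (fun j hj => by simp [hj])
    rw [Finset.sum_congr (g := fun j => a j * (Real.pi * ((e i - j : ℤ) : ℝ))⁻¹) rfl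
      fun j hj => by simp [hj]] at this
    rw [← this]
    refine Finset.sum_congr rfl fun j _ => ?_
    simp only [e]
    congr 4
    ring
  have e2 : ∑ j ∈ Finset.range (2 * M), |if e j ∈ S then a (e j) else 0| ^ p =
      ∑ j ∈ S, |a j| ^ p := by
    rw [hsum (fun j => |if j ∈ S then a j else 0| ^ p)
      (fun j hj => by simp [hj, Real.zero_rpow hp0.ne'])]
    exact Finset.sum_congr rfl fun j hj => by rw [if_pos hj]
  simp only [e1] at h
  rw [e2] at h
  refine le_trans ?_ h
  rw [← Finset.sum_image (fun x _ y _ h => he h)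
    (f := fun i => |∑ j ∈ S, a j * (Real.pi * ((i - j : ℤ) : ℝ))⁻¹| ^ p)]
  exact Finset.sum_le_sum_of_subset_of_nonneg hsub fun i _ _ => Real.rpow_nonneg (abs_nonneg _) _

lemma Cconst_of_le_two {p : ℝ} (hp : 1 < p) (hp2 : p ≤ 2) :
    Cconst p = Real.tan (Real.pi / (2 * p)) := by
  have h1 : 0 < p - 1 := by linarith
  have : pstar p = p / (p - 1) := by
    refine max_eq_right ?_
    rw [le_div_iff₀ h1]
    nlinarith
  rw [Cconst, this, ← Real.tan_inv_eq_cot, ← Real.tan_pi_div_two_sub]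
  congr 1
  field_simp
  ring

lemma pstar_conj {p : ℝ} (hp : 1 < p) : pstar (p / (p - 1)) = pstar p := by
  have h1 : p - 1 ≠ 0 := by linarith
  rw [pstar, pstar, max_comm]
  congr 1
  field_simp
  ring

lemma Cconst_conj {p : ℝ} (hp : 1 < p) : Cconst (p / (p - 1)) = Cconst p := by
  rw [Cconst, Cconst, pstar_conj hp]

lemma Cconst_nonneg {p : ℝ} (hp : 1 < p) : 0 ≤ Cconst p := by
  have h2 : 1 < pstar p := lt_of_lt_of_le hp (le_max_left _ _)
  rw [Cconst, ← Real.tan_inv_eq_cot, ← Real.tan_pi_div_two_sub]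
  have h3 : Real.pi / (2 * pstar p) ≤ Real.pi / 2 :=
    div_le_div_of_nonneg_left Real.pi_pos.le (by norm_num) (by linarith)
  refine Real.tan_nonneg_of_nonneg_of_le_pi_div_two (by linarith) ?_
  have : 0 ≤ Real.pi / (2 * pstar p) := by positivity
  linarith

lemma sum_rpow_hilbert_le {p : ℝ} (hp : 1 < p) (S : Finset ℤ) (a : ℤ → ℝ) :
    ∑ i ∈ S, |∑ j ∈ S, a j * (Real.pi * ((i - j : ℤ) : ℝ))⁻¹| ^ p ≤
      Cconst p ^ p * ∑ j ∈ S, |a j| ^ p := by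
  rcases le_total p 2 with hp2 | hp2
  · rw [Cconst_of_le_two hp hp2]
    exact sum_rpow_hilbert_le_of_le_two hp hp2 S a
  have hp0 : 0 < p := by linarith
  have hp1 : 0 < p - 1 := by linarith
  have hpq := Real.HolderConjugate.conjExponent hp
  set q := Real.conjExponent p with hq
  have hqp : q = p / (p - 1) := rfl
  have hq1 : 1 < q := hpq.symm.lt
  have hq2 : q ≤ 2 := by rw [hqp, div_le_iff₀ hp1]; linarith
  have hC : Cconst p = Real.tan (Real.pi / (2 * q)) := by
    rw [← Cconst_conj hp, ← hqp, Cconst_of_le_two hq1 hq2]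
  have hC0 := Cconst_nonneg hp
  set b : ℤ → ℝ := fun i => ∑ j ∈ S, a j * (Real.pi * ((i - j : ℤ) : ℝ))⁻¹ with hb
  let c : ℤ → ℝ := fun i => |b i| ^ (p - 2) * b i
  have hcb : ∀ i, c i * b i = |b i| ^ p := by
    intro i
    rcases eq_or_ne (b i) 0 with h | h
    · simp [c, h, Real.zero_rpow hp0.ne']
    · have h' : 0 < |b i| := abs_pos.2 h
      simp only [c]
      rw [mul_assoc, ← sq, ← sq_abs, ← Real.rpow_natCast, ← Real.rpow_add h']
      norm_num
  have hcq : ∀ i, |c i| ^ q = |b i| ^ p := by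
    intro i
    rcases eq_or_ne (b i) 0 with h | h
    · simp [c, h, Real.zero_rpow hp0.ne', Real.zero_rpow (by linarith : q ≠ 0)]
    · have h' : 0 < |b i| := abs_pos.2 h
      simp only [c]
      rw [abs_mul, abs_of_nonneg (Real.rpow_nonneg (abs_nonneg _) _), ← Real.rpow_add_one h'.ne',
        ← Real.rpow_mul h'.le, hqp]
      congr 1
      field_simp
      ring
  set A := ∑ j ∈ S, |a j| ^ p with hA
  set B := ∑ i ∈ S, |b i| ^ p with hB
  have hA0 : 0 ≤ A := Finset.sum_nonneg fun _ _ => Real.rpow_nonneg (abs_nonneg _) _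
  have hB0 : 0 ≤ B := Finset.sum_nonneg fun _ _ => Real.rpow_nonneg (abs_nonneg _) _
  have hdual := sum_rpow_hilbert_le_of_le_two hq1 hq2 S c
  rw [← hC, Finset.sum_congr rfl fun i _ => hcq i, ← hB] at hdual
  have hBsum : B = ∑ j ∈ S, a j * -∑ i ∈ S, c i * (Real.pi * ((j - i : ℤ) : ℝ))⁻¹ := by
    rw [hB, ← Finset.sum_congr rfl fun i _ => hcb i]
    simp only [hb, Finset.mul_sum, ← Finset.sum_neg_distrib]
    rw [Finset.sum_comm]
    refine Finset.sum_congr rfl fun j _ => Finset.sum_congr rfl fun i _ => ?_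
    have : ((j - i : ℤ) : ℝ) = -((i - j : ℤ) : ℝ) := by push_cast; ring
    rw [this, mul_neg Real.pi, inv_neg]
    ring
  have hHol := Real.inner_le_Lp_mul_Lq S a
    (fun j => -∑ i ∈ S, c i * (Real.pi * ((j - i : ℤ) : ℝ))⁻¹) hpq
  rw [← hBsum, ← hA] at hHol
  simp only [abs_neg] at hHol
  have hle : B ≤ A ^ (1 / p) * (Cconst p * B ^ (1 / q)) := by
    refine hHol.trans (mul_le_mul_of_nonneg_left ?_ (Real.rpow_nonneg hA0 _))
    refine (Real.rpow_le_rpow (Finset.sum_nonneg fun _ _ =>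
      Real.rpow_nonneg (abs_nonneg _) _) hdual (by positivity)).trans_eq ?_
    rw [Real.mul_rpow (Real.rpow_nonneg hC0 _) hB0, one_div, Real.rpow_rpow_inv hC0 (by linarith)]
  rcases hB0.eq_or_lt with h | h
  · rw [← h]; positivity
  have hs : B = B ^ (1 / p) * B ^ (1 / q) := by
    rw [← Real.rpow_add h, one_div, one_div, hpq.inv_add_inv_eq_one, Real.rpow_one]
  have h3 : B ^ (1 / p) ≤ Cconst p * A ^ (1 / p) := by
    have h4 : 0 < B ^ (1 / q) := Real.rpow_pos_of_pos h _
    refine le_of_mul_le_mul_right ?_ h4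
    rw [← hs]
    linarith
  have h5 := Real.rpow_le_rpow (Real.rpow_nonneg hB0 _) h3 hp0.le
  rwa [Real.mul_rpow hC0 (Real.rpow_nonneg hA0 _), one_div, Real.rpow_inv_rpow hB0 hp0.ne',
    Real.rpow_inv_rpow hA0 hp0.ne'] at h5

lemma integral_abs_re_rotation_rpow (p : ℝ) (z : ℂ) :
    ∫ t in (0 : ℝ)..2 * Real.pi, |(Complex.exp (t * Complex.I) * z).re| ^ p =
      ‖z‖ ^ p * ∫ t in (0 : ℝ)..2 * Real.pi, |Real.cos t| ^ p := by
  have e : ∀ t : ℝ, |(Complex.exp (t * Complex.I) * z).re| ^ p =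
      ‖z‖ ^ p * |Real.cos (t + z.arg)| ^ p := by
    intro t
    have h1 : Complex.exp (t * Complex.I) * z =
        ‖z‖ * Complex.exp (((t + z.arg : ℝ) : ℂ) * Complex.I) := by
      conv_lhs => rw [← Complex.norm_mul_exp_arg_mul_I z]
      rw [mul_left_comm, ← Complex.exp_add]
      push_cast
      ring_nf
    rw [h1, Complex.re_ofReal_mul, Complex.exp_ofReal_mul_I_re, abs_mul, abs_norm,
      Real.mul_rpow (norm_nonneg _) (abs_nonneg _)]
  simp only [e]
  rw [intervalIntegral.integral_const_mul,
    intervalIntegral.integral_comp_add_right fun t => |Real.cos t| ^ p, zero_add]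
  have hper : Function.Periodic (fun t => |Real.cos t| ^ p) (2 * Real.pi) := fun t => by
    simp only [Real.cos_add_two_pi]
  have := hper.intervalIntegral_add_eq z.arg 0
  rw [zero_add, add_comm] at this
  rw [this]

lemma integral_abs_cos_rpow_pos {p : ℝ} (hp : 0 < p) :
    0 < ∫ t in (0 : ℝ)..2 * Real.pi, |Real.cos t| ^ p := by
  have hc : Continuous fun t => |Real.cos t| ^ p :=
    Real.continuous_cos.abs.rpow_const fun _ => Or.inr hp.le
  refine intervalIntegral.integral_pos Real.two_pi_pos hc.continuousOn
    (fun t _ => Real.rpow_nonneg (abs_nonneg _) _) ⟨0, ⟨le_rfl, Real.two_pi_pos.le⟩, by simp⟩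

lemma sum_rpow_norm_hilbert_le {p : ℝ} (hp : 1 < p) (S : Finset ℤ) (a : ℤ → ℂ) :
    ∑ i ∈ S, ‖∑ j ∈ S, a j * (((Real.pi * ((i - j : ℤ) : ℝ))⁻¹ : ℝ) : ℂ)‖ ^ p ≤
      Cconst p ^ p * ∑ j ∈ S, ‖a j‖ ^ p := by
  have hp0 : 0 < p := by linarith
  have hpos := integral_abs_cos_rpow_pos hp0
  set κ := ∫ t in (0 : ℝ)..2 * Real.pi, |Real.cos t| ^ p
  have hcont : ∀ z : ℂ, Continuous fun t : ℝ => |(Complex.exp (t * Complex.I) * z).re| ^ p :=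
    fun z => Continuous.rpow_const (by fun_prop) fun _ => Or.inr hp0.le
  refine le_of_mul_le_mul_right ?_ hpos
  rw [mul_assoc, Finset.sum_mul, Finset.sum_mul]
  simp only [← integral_abs_re_rotation_rpow p, κ]
  rw [← intervalIntegral.integral_finsetSum fun i _ => (hcont _).intervalIntegrable _ _,
    ← intervalIntegral.integral_finsetSum fun i _ => (hcont _).intervalIntegrable _ _,
    ← intervalIntegral.integral_const_mul]
  refine intervalIntegral.integral_mono_on Real.two_pi_pos.le
    ((continuous_finsetSum _ fun i _ => hcont _).intervalIntegrable _ _)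
    (((continuous_finsetSum _ fun i _ => hcont _).const_mul _).intervalIntegrable _ _) fun t _ => ?_
  have h := sum_rpow_hilbert_le hp S fun j => (Complex.exp (t * Complex.I) * a j).re
  refine le_trans (le_of_eq ?_) h
  refine Finset.sum_congr rfl fun i _ => ?_
  congr 2
  rw [Finset.mul_sum, Complex.re_sum]
  refine Finset.sum_congr rfl fun j _ => ?_
  rw [← mul_assoc, Complex.re_mul_ofReal]

lemma lpNorm_nonneg (p : ℝ) (a : ℤ → ℂ) : 0 ≤ lpNorm p a :=
  Real.rpow_nonneg (tsum_nonneg fun _ => Real.rpow_nonneg (norm_nonneg _) _) _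

lemma lpNorm_rpow {p : ℝ} (hp : 0 < p) (a : ℤ → ℂ) : lpNorm p a ^ p = ∑' n, ‖a n‖ ^ p := by
  rw [_root_.lpNorm, one_div,
    Real.rpow_inv_rpow (tsum_nonneg fun _ => Real.rpow_nonneg (norm_nonneg _) _) hp.ne']

lemma lpNorm_le_mul_iff {p C : ℝ} (hp : 0 < p) (hC : 0 ≤ C) (a b : ℤ → ℂ) :
    lpNorm p b ≤ C * lpNorm p a ↔ ∑' n, ‖b n‖ ^ p ≤ C ^ p * ∑' n, ‖a n‖ ^ p := by
  rw [← lpNorm_rpow hp a, ← lpNorm_rpow hp b, ← Real.mul_rpow hC (lpNorm_nonneg p a)]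
  exact (Real.rpow_le_rpow_iff (lpNorm_nonneg p b) (mul_nonneg hC (lpNorm_nonneg p a)) hp).symm

lemma lpNorm_const_mul {p : ℝ} (hp : 0 < p) (c : ℂ) (a : ℤ → ℂ) :
    lpNorm p (fun n => c * a n) = ‖c‖ * lpNorm p a := by
  simp only [_root_.lpNorm, norm_mul, Real.mul_rpow (norm_nonneg _) (norm_nonneg _), tsum_mul_left]
  rw [Real.mul_rpow (Real.rpow_nonneg (norm_nonneg _) _)
    (tsum_nonneg fun _ => Real.rpow_nonneg (norm_nonneg _) _), one_div,
    Real.rpow_rpow_inv (norm_nonneg _) hp.ne']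

lemma MemLpZ.const_mul {p : ℝ} {a : ℤ → ℂ} (ha : MemLpZ p a) (c : ℂ) :
    MemLpZ p fun n => c * a n := by
  simp only [MemLpZ, norm_mul, Real.mul_rpow (norm_nonneg _) (norm_nonneg _)]
  exact Summable.mul_left _ ha

lemma MemLpZ.add {p : ℝ} (hp : 1 ≤ p) {a b : ℤ → ℂ} (ha : MemLpZ p a) (hb : MemLpZ p b) :
    MemLpZ p fun n => a n + b n := by
  have h := Real.summable_Lp_add_of_nonneg hp (fun n => norm_nonneg (a n))
    (fun n => norm_nonneg (b n)) ha hb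
  exact Summable.of_nonneg_of_le (fun _ => Real.rpow_nonneg (norm_nonneg _) _)
    (fun n => Real.rpow_le_rpow (norm_nonneg _) (norm_add_le _ _) (by linarith)) h

lemma lpNorm_add_le {p : ℝ} (hp : 1 ≤ p) {a b : ℤ → ℂ} (ha : MemLpZ p a) (hb : MemLpZ p b) :
    lpNorm p (fun n => a n + b n) ≤ lpNorm p a + lpNorm p b := by
  have h := Real.summable_Lp_add_of_nonneg hp (fun n => norm_nonneg (a n))
    (fun n => norm_nonneg (b n)) ha hb
  refine le_trans ?_ (Real.Lp_add_le_tsum_of_nonneg hp (fun n => norm_nonneg (a n))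
    (fun n => norm_nonneg (b n)) ha hb).2
  refine Real.rpow_le_rpow (tsum_nonneg fun _ => Real.rpow_nonneg (norm_nonneg _) _) ?_
    (by positivity)
  exact Summable.tsum_le_tsum (fun n => Real.rpow_le_rpow (norm_nonneg _) (norm_add_le _ _)
    (by linarith)) (MemLpZ.add hp ha hb) h

lemma summable_div_int {p : ℝ} (hp : 1 < p) {a : ℤ → ℂ} (ha : MemLpZ p a) (n : ℤ) :
    Summable fun m : ℤ => a (n - m) / (m : ℂ) := by
  have hpq := Real.HolderConjugate.conjExponent hp
  have h1 : Summable fun m : ℤ => ‖a (n - m)‖ ^ p := (Equiv.subLeft n).summable_iff.2 ha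
  have h2 : Summable fun m : ℤ => (|(m : ℝ)|⁻¹) ^ Real.conjExponent p := by
    refine (Real.summable_abs_int_rpow hpq.symm.lt).congr fun m => ?_
    rw [Real.inv_rpow (abs_nonneg _), Real.rpow_neg (abs_nonneg _)]
  refine Summable.of_norm ?_
  refine (Real.summable_mul_of_Lp_Lq_of_nonneg hpq (fun m => norm_nonneg (a (n - m)))
    (fun m : ℤ => inv_nonneg.2 (abs_nonneg (m : ℝ))) h1 h2).congr fun m => ?_
  rw [norm_div, Complex.norm_intCast, div_eq_mul_inv]

lemma H0T_eq_tsum (a : ℤ → ℂ) (n : ℤ) :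
    H0T a n = (1 / (Real.pi : ℂ)) * ∑' m : ℤ, a (n - m) / (m : ℂ) := by
  rw [H0T]
  congr 1
  refine tsum_subtype_eq_of_support_subset (s := {m : ℤ | m ≠ 0}) (f := fun m : ℤ =>
    a (n - m) / (m : ℂ)) fun m hm => ?_
  rintro rfl
  simp at hm

lemma hasSum_H0T {p : ℝ} (hp : 1 < p) {a : ℤ → ℂ} (ha : MemLpZ p a) (n : ℤ) :
    HasSum (fun j : ℤ => a j * (((Real.pi * ((n - j : ℤ) : ℝ))⁻¹ : ℝ) : ℂ)) (H0T a n) := by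
  have h := ((summable_div_int hp ha n).hasSum).mul_left (1 / (Real.pi : ℂ))
  rw [← H0T_eq_tsum] at h
  have h' := (Equiv.subLeft n).hasSum_iff.2 h
  refine h'.congr_fun fun j => ?_
  simp [Function.comp]
  ring

lemma sum_rpow_H0T_le {p : ℝ} (hp : 1 < p) {a : ℤ → ℂ} (ha : MemLpZ p a) (S : Finset ℤ) :
    ∑ i ∈ S, ‖H0T a i‖ ^ p ≤ Cconst p ^ p * ∑' n, ‖a n‖ ^ p := by
  have hp0 : 0 < p := by linarith
  have hlim : Filter.Tendsto (fun S' : Finset ℤ => ∑ i ∈ S,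
      ‖∑ j ∈ S', a j * (((Real.pi * ((i - j : ℤ) : ℝ))⁻¹ : ℝ) : ℂ)‖ ^ p) Filter.atTop
      (nhds (∑ i ∈ S, ‖H0T a i‖ ^ p)) :=
    tendsto_finsetSum _ fun i _ => (hasSum_H0T hp ha i).norm.rpow_const (Or.inr hp0.le)
  refine le_of_tendsto hlim ?_
  filter_upwards [Filter.eventually_ge_atTop S] with S' hS
  calc _ ≤ ∑ i ∈ S', ‖∑ j ∈ S', a j * (((Real.pi * ((i - j : ℤ) : ℝ))⁻¹ : ℝ) : ℂ)‖ ^ p :=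
        Finset.sum_le_sum_of_subset_of_nonneg hS fun _ _ _ => Real.rpow_nonneg (norm_nonneg _) _
    _ ≤ _ := sum_rpow_norm_hilbert_le hp S' a
    _ ≤ _ := mul_le_mul_of_nonneg_left
        (Summable.sum_le_tsum _ (fun _ _ => Real.rpow_nonneg (norm_nonneg _) _) ha)
        (Real.rpow_nonneg (Cconst_nonneg hp) _)

lemma MemLpZ.H0T {p : ℝ} (hp : 1 < p) {a : ℤ → ℂ} (ha : MemLpZ p a) : MemLpZ p (H0T a) :=
  summable_of_sum_le (fun _ => Real.rpow_nonneg (norm_nonneg _) _) (sum_rpow_H0T_le hp ha)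

lemma lpNorm_H0T_le {p : ℝ} (hp : 1 < p) {a : ℤ → ℂ} (ha : MemLpZ p a) :
    lpNorm p (H0T a) ≤ Cconst p * lpNorm p a := by
  rw [lpNorm_le_mul_iff (by linarith) (Cconst_nonneg hp)]
  exact (ha.H0T hp).tsum_le_of_sum_le (sum_rpow_H0T_le hp ha)

lemma hasSum_int_even_odd {α : Type*} [AddCommMonoid α] [TopologicalSpace α] [ContinuousAdd α]
    {f : ℤ → α} {x y : α} {s : ℤ} (hs : Odd s) (hx : HasSum (fun k => f (2 * k)) x)
    (hy : HasSum (fun k => f (2 * k + s)) y) : HasSum f (x + y) := by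
  have h1 : Function.Injective fun k : ℤ => 2 * k := fun a b h => by simpa using h
  have h2 : Function.Injective fun k : ℤ => 2 * k + s := fun a b h => by simpa using h
  rw [show (fun k => f (2 * k)) = f ∘ fun k : ℤ => 2 * k from rfl, ← h1.hasSum_range_iff] at hx
  rw [show (fun k => f (2 * k + s)) = f ∘ fun k : ℤ => 2 * k + s from rfl,
    ← h2.hasSum_range_iff] at hy
  obtain ⟨r, rfl⟩ := hs
  refine hx.add_isCompl ⟨?_, ?_⟩ hy
  · rw [Set.disjoint_iff]
    rintro n ⟨⟨a, rfl⟩, ⟨b, hb⟩⟩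
    simp only at hb
    omega
  · rw [codisjoint_iff]
    refine Set.eq_univ_of_forall fun n => ?_
    rcases Int.even_or_odd' n with ⟨k, rfl | rfl⟩
    · exact Or.inl ⟨k, rfl⟩
    · exact Or.inr ⟨k - r, by simp only; ring⟩

lemma MemLpZ.of_even_odd {p : ℝ} {a : ℤ → ℂ} {s : ℤ} (hs : Odd s)
    (h0 : MemLpZ p fun k => a (2 * k)) (h1 : MemLpZ p fun k => a (2 * k + s)) : MemLpZ p a :=
  (hasSum_int_even_odd (f := fun n => ‖a n‖ ^ p) hs h0.hasSum h1.hasSum).summable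

lemma tsum_norm_rpow_even_odd {p : ℝ} {a : ℤ → ℂ} {s : ℤ} (hs : Odd s)
    (h0 : MemLpZ p fun k => a (2 * k)) (h1 : MemLpZ p fun k => a (2 * k + s)) :
    ∑' n, ‖a n‖ ^ p = ∑' k, ‖a (2 * k)‖ ^ p + ∑' k, ‖a (2 * k + s)‖ ^ p :=
  (hasSum_int_even_odd (f := fun n => ‖a n‖ ^ p) hs h0.hasSum h1.hasSum).tsum_eq

lemma MemLpZ.even {p : ℝ} {a : ℤ → ℂ} (ha : MemLpZ p a) : MemLpZ p fun k => a (2 * k) :=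
  Summable.comp_injective ha (i := fun k : ℤ => 2 * k) fun x y h => by simpa using h

lemma MemLpZ.odd {p : ℝ} {a : ℤ → ℂ} (ha : MemLpZ p a) (s : ℤ) :
    MemLpZ p fun k => a (2 * k + s) :=
  Summable.comp_injective ha (i := fun k : ℤ => 2 * k + s) fun x y h => by simpa using h

/-- The sequence equal to `b` on the even integers and zero on the odd integers. -/
def evenSpread (b : ℤ → ℂ) (n : ℤ) : ℂ := if Even n then b (n / 2) else 0

lemma evenSpread_even (b : ℤ → ℂ) : (fun k => evenSpread b (2 * k)) = b := by
  funext k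
  simp [evenSpread]

lemma evenSpread_odd (b : ℤ → ℂ) {s : ℤ} (hs : Odd s) : (fun k => evenSpread b (2 * k + s)) = 0 := by
  funext k
  have : ¬ Even (2 * k + s) := Int.not_even_iff_odd.2 ((even_two_mul k).add_odd hs)
  simp [evenSpread, this]

lemma MemLpZ.zero {p : ℝ} (hp : 0 < p) : MemLpZ p 0 := by
  simp only [MemLpZ, Pi.zero_apply, norm_zero, Real.zero_rpow hp.ne']
  exact summable_zero

lemma MemLpZ.evenSpread {p : ℝ} (hp : 0 < p) {b : ℤ → ℂ} (hb : MemLpZ p b) :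
    MemLpZ p (evenSpread b) :=
  MemLpZ.of_even_odd odd_one (by rwa [evenSpread_even]) (by
    rw [evenSpread_odd b odd_one]; exact MemLpZ.zero hp)

/-- If an operator splits into two copies of another one along the parity of the index, then both
have the same admissible bounds on `ℓ^p`. -/
lemma bound_iff_of_parity_split {p C : ℝ} (hp : 0 < p) (hC : 0 ≤ C) {s : ℤ} (hs : Odd s)
    {T T' : (ℤ → ℂ) → ℤ → ℂ} (h0 : T' 0 = 0)
    (hN : ∀ a, MemLpZ p a → ∑' n, ‖T a n‖ ^ p =
      ∑' n, ‖T' (fun k => a (2 * k)) n‖ ^ p + ∑' n, ‖T' (fun k => a (2 * k + s)) n‖ ^ p) :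
    (∀ a, MemLpZ p a → lpNorm p (T a) ≤ C * lpNorm p a) ↔
      ∀ a, MemLpZ p a → lpNorm p (T' a) ≤ C * lpNorm p a := by
  simp only [lpNorm_le_mul_iff hp hC]
  constructor
  · intro h b hb
    have hm := hb.evenSpread hp
    have h1 := h _ hm
    rw [hN _ hm, tsum_norm_rpow_even_odd hs hm.even (hm.odd s)] at h1
    have e0 := evenSpread_even b
    have e1 := evenSpread_odd b hs
    have e2 : ∑' k, ‖_root_.evenSpread b (2 * k + s)‖ ^ p = 0 := by
      rw [tsum_congr fun k => by rw [congrFun e1 k]]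
      simp [Real.zero_rpow hp.ne']
    have e3 : ∑' k, ‖_root_.evenSpread b (2 * k)‖ ^ p = ∑' k, ‖b k‖ ^ p :=
      tsum_congr fun k => by rw [congrFun e0 k]
    rw [e2, e3, e0, e1, h0] at h1
    simpa [Real.zero_rpow hp.ne'] using h1
  · intro h a ha
    rw [hN a ha, tsum_norm_rpow_even_odd hs ha.even (ha.odd s), mul_add]
    exact add_le_add (h _ ha.even) (h _ (ha.odd s))

lemma HT_shift (a : ℤ → ℂ) (n s : ℤ) : HT a (2 * n + s) = H0T (fun k => a (2 * k + s)) n := by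
  let e : {m : ℤ // m ≠ 0} ≃ {m : ℤ // Even m ∧ m ≠ 0} :=
    { toFun := fun m => ⟨2 * m, even_two_mul _, by simpa using m.2⟩
      invFun := fun m => ⟨m / 2, by
        obtain ⟨⟨k, hk⟩, hm⟩ := m.2
        omega⟩
      left_inv := fun m => by ext; simp
      right_inv := fun m => by
        ext
        obtain ⟨⟨k, hk⟩, hm⟩ := m.2
        simp only
        omega }
  rw [HT, H0T, ← e.tsum_eq, ← tsum_mul_left, ← tsum_mul_left]
  refine tsum_congr fun m => ?_
  have hm : ((m : ℤ) : ℂ) ≠ 0 := by exact_mod_cast m.2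
  have hπ : (Real.pi : ℂ) ≠ 0 := by exact_mod_cast Real.pi_ne_zero
  simp only [e, Equiv.coe_fn_mk]
  rw [show 2 * n + s - 2 * (m : ℤ) = 2 * (n - m) + s by ring]
  push_cast
  field_simp

lemma KT_shift (a : ℤ → ℂ) (n s : ℤ) : KT a (2 * n + s + 1) = RT (fun k => a (2 * k + s)) n := by
  let e : ℤ ≃ {m : ℤ // Odd m} :=
    { toFun := fun m => ⟨2 * m + 1, odd_two_mul_add_one _⟩
      invFun := fun m => m / 2
      left_inv := fun m => by simp only; omega
      right_inv := fun m => by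
        ext
        obtain ⟨k, hk⟩ := m.2
        simp only
        omega }
  rw [KT, RT, ← e.tsum_eq, ← tsum_mul_left, ← tsum_mul_left]
  refine tsum_congr fun m => ?_
  have hm : (2 * (m : ℂ) + 1) ≠ 0 := by
    have : 2 * m + 1 ≠ 0 := by omega
    exact_mod_cast this
  have hm' : (m : ℂ) + 1 / 2 ≠ 0 := by
    intro h
    apply hm
    linear_combination 2 * h
  have hπ : (Real.pi : ℂ) ≠ 0 := by exact_mod_cast Real.pi_ne_zero
  simp only [e, Equiv.coe_fn_mk]
  rw [show 2 * n + s + 1 - (2 * m + 1) = 2 * (n - m) + s by ring]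
  push_cast
  rw [show (m : ℂ) + 1 / 2 = (2 * m + 1) / 2 by ring]
  field_simp

lemma HT_add_KT {p : ℝ} (hp : 1 < p) {a : ℤ → ℂ} (ha : MemLpZ p a) (n : ℤ) :
    HT a n + KT a n = 2 * H0T a n := by
  have hs := summable_div_int hp ha n
  have h1 : ∑' m : {m : ℤ // Even m ∧ m ≠ 0}, a (n - (m : ℤ)) / ((m : ℤ) : ℂ) =
      ∑' m : ({m : ℤ | Odd m}ᶜ : Set ℤ), a (n - (m : ℤ)) / ((m : ℤ) : ℂ) := by
    rw [tsum_subtype ({m : ℤ | Odd m}ᶜ) fun m : ℤ => a (n - m) / (m : ℂ)]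
    refine (tsum_subtype {m : ℤ | Even m ∧ m ≠ 0} fun m : ℤ => a (n - m) / (m : ℂ)).trans ?_
    refine tsum_congr fun m => ?_
    rcases eq_or_ne m 0 with rfl | hm
    · simp [Set.indicator]
    · simp [Set.indicator, hm]
  have h2 := Summable.tsum_add_tsum_compl (s := {m : ℤ | Odd m}) (hs.subtype _) (hs.subtype _)
  have h3 : ∑' m : {m : ℤ // Odd m}, a (n - (m : ℤ)) / ((m : ℤ) : ℂ) =
      ∑' m : ({m : ℤ | Odd m} : Set ℤ), a (n - (m : ℤ)) / ((m : ℤ) : ℂ) := rfl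
  rw [H0T_eq_tsum, HT, KT, h1, h3, ← h2]
  ring

lemma MemLpZ.HT {p : ℝ} (hp : 1 < p) {a : ℤ → ℂ} (ha : MemLpZ p a) : MemLpZ p (HT a) := by
  refine MemLpZ.of_even_odd odd_one ?_ ?_
  · have : (fun k => _root_.HT a (2 * k)) = _root_.H0T fun k => a (2 * k) := by
      funext n; simpa using HT_shift a n 0
    rw [this]
    exact ha.even.H0T hp
  · have : (fun k => _root_.HT a (2 * k + 1)) = _root_.H0T fun k => a (2 * k + 1) := by
      funext n; exact HT_shift a n 1
    rw [this]
    exact (ha.odd 1).H0T hp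

lemma KT_eq {p : ℝ} (hp : 1 < p) {a : ℤ → ℂ} (ha : MemLpZ p a) :
    KT a = fun n => 2 * H0T a n + (-1) * HT a n := by
  funext n
  rw [← HT_add_KT hp ha]
  ring

lemma MemLpZ.KT {p : ℝ} (hp : 1 < p) {a : ℤ → ℂ} (ha : MemLpZ p a) : MemLpZ p (KT a) := by
  rw [KT_eq hp ha]
  exact ((ha.H0T hp).const_mul 2).add hp.le ((ha.HT hp).const_mul (-1))

lemma MemLpZ.RT {p : ℝ} (hp : 1 < p) {b : ℤ → ℂ} (hb : MemLpZ p b) : MemLpZ p (RT b) := by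
  have h := ((hb.evenSpread (by linarith)).KT hp).odd 1
  have : (fun k => _root_.KT (_root_.evenSpread b) (2 * k + 1)) = _root_.RT b := by
    funext n
    have := KT_shift (_root_.evenSpread b) n 0
    simp only [add_zero] at this
    rw [this, evenSpread_even]
  rwa [this] at h

lemma H0T_zero : H0T 0 = 0 := by
  funext n; simp [H0T]

lemma RT_zero : RT 0 = 0 := by
  funext n; simp [RT]

lemma HT_bound_iff {p C : ℝ} (hp : 1 < p) (hC : 0 ≤ C) :
    (∀ a, MemLpZ p a → lpNorm p (HT a) ≤ C * lpNorm p a) ↔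
      ∀ a, MemLpZ p a → lpNorm p (H0T a) ≤ C * lpNorm p a := by
  refine bound_iff_of_parity_split (by linarith) hC odd_one H0T_zero fun a ha => ?_
  rw [tsum_norm_rpow_even_odd odd_one (ha.HT hp).even ((ha.HT hp).odd 1)]
  congr 1
  · exact tsum_congr fun n => by simpa using congrArg (fun z => ‖z‖ ^ p) (HT_shift a n 0)
  · exact tsum_congr fun n => by rw [HT_shift]

lemma KT_bound_iff {p C : ℝ} (hp : 1 < p) (hC : 0 ≤ C) :
    (∀ a, MemLpZ p a → lpNorm p (KT a) ≤ C * lpNorm p a) ↔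
      ∀ a, MemLpZ p a → lpNorm p (RT a) ≤ C * lpNorm p a := by
  refine bound_iff_of_parity_split (by linarith) hC (s := -1) (by decide) RT_zero fun a ha => ?_
  rw [tsum_norm_rpow_even_odd odd_one (ha.KT hp).even ((ha.KT hp).odd 1), add_comm]
  congr 1
  · exact tsum_congr fun n => by simpa using congrArg (fun z => ‖z‖ ^ p) (KT_shift a n 0)
  · exact tsum_congr fun n => by simpa using congrArg (fun z => ‖z‖ ^ p) (KT_shift a n (-1))

lemma lpNorm_HT_le {p : ℝ} (hp : 1 < p) {a : ℤ → ℂ} (ha : MemLpZ p a) :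
    lpNorm p (HT a) ≤ Cconst p * lpNorm p a :=
  (HT_bound_iff hp (Cconst_nonneg hp)).2 (fun _ hb => lpNorm_H0T_le hp hb) a ha

lemma lpNorm_KT_le {p : ℝ} (hp : 1 < p) {a : ℤ → ℂ} (ha : MemLpZ p a) :
    lpNorm p (KT a) ≤ 3 * Cconst p * lpNorm p a := by
  have h := lpNorm_add_le hp.le ((ha.H0T hp).const_mul 2) ((ha.HT hp).const_mul (-1))
  rw [← KT_eq hp ha, lpNorm_const_mul (by linarith), lpNorm_const_mul (by linarith)] at h
  have h1 := lpNorm_H0T_le hp ha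
  have h2 := lpNorm_HT_le hp ha
  norm_num at h
  linarith

lemma lpNorm_H0T_le_of_KT {p C : ℝ} (hp : 1 < p)
    (h : ∀ a, MemLpZ p a → lpNorm p (KT a) ≤ C * lpNorm p a) {a : ℤ → ℂ} (ha : MemLpZ p a) :
    lpNorm p (H0T a) ≤ (Cconst p + C) / 2 * lpNorm p a := by
  have e : (fun n => HT a n + KT a n) = fun n => 2 * H0T a n := by
    funext n; exact HT_add_KT hp ha n
  have h0 := lpNorm_add_le hp.le (ha.HT hp) (ha.KT hp)
  rw [e, lpNorm_const_mul (by linarith)] at h0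
  have h1 := lpNorm_HT_le hp ha
  have h2 := h a ha
  norm_num at h0
  linarith

open Filter Topology in
lemma tendsto_sum_div_sum_of_tendsto {u g : ℕ → ℝ} {L : ℝ} (hg : 0 ≤ g)
    (hg' : Tendsto (fun n => ∑ i ∈ Finset.range n, g i) atTop atTop) (hu : Tendsto u atTop (𝓝 L)) :
    Tendsto (fun n => (∑ i ∈ Finset.range n, u i * g i) / ∑ i ∈ Finset.range n, g i) atTop
      (𝓝 L) := by
  have h1 : (fun i => (u i - L) * g i) =o[atTop] g := by
    have : (fun i => u i - L) =o[atTop] fun _ => (1 : ℝ) := by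
      rw [Asymptotics.isLittleO_one_iff]
      simpa using hu.sub_const L
    simpa using this.mul_isBigO (Asymptotics.isBigO_refl g atTop)
  have h2 := (h1.sum_range hg hg').tendsto_div_nhds_zero.add_const L
  rw [zero_add] at h2
  refine h2.congr' ?_
  filter_upwards [hg'.eventually_gt_atTop 0] with n hn
  rw [div_add' _ _ _ hn.ne', Finset.mul_sum, ← Finset.sum_add_distrib]
  congr 1
  exact Finset.sum_congr rfl fun i _ => by ring

open Filter Topology in
lemma tendsto_rpow_div_rpow_sub {β : ℝ} (hβ : 0 < β) :
    Tendsto (fun m : ℕ => (m : ℝ) ^ (β - 1) / (((m + 1 : ℕ) : ℝ) ^ β - (m : ℝ) ^ β)) atTop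
      (𝓝 β⁻¹) := by
  have hd : HasDerivAt (fun x : ℝ => x ^ β) β 1 := by
    simpa using Real.hasDerivAt_rpow_const (x := 1) (p := β) (Or.inl one_ne_zero)
  have h := hd.tendsto_slope_zero_right
  have ht : Tendsto (fun m : ℕ => ((m : ℝ))⁻¹) atTop (𝓝[>] 0) :=
    tendsto_inv_atTop_nhdsGT_zero.comp tendsto_natCast_atTop_atTop
  refine ((h.comp ht).inv₀ hβ.ne').congr' ?_
  filter_upwards [eventually_gt_atTop 0] with m hm
  have hm' : (0 : ℝ) < m := by exact_mod_cast hm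
  have e1 : ((m + 1 : ℕ) : ℝ) = m * (1 + (m : ℝ)⁻¹) := by
    push_cast; field_simp
  have h3 : (0 : ℝ) < m ^ β := Real.rpow_pos_of_pos hm' _
  simp only [Function.comp, inv_inv, smul_eq_mul, Real.one_rpow]
  rw [e1, Real.mul_rpow hm'.le (by positivity), Real.rpow_sub_one hm'.ne', ← mul_sub_one,
    mul_inv, div_div, mul_left_comm, ← div_div, div_self h3.ne', one_div, mul_inv]

open Filter Topology in
lemma tendsto_riemannSum_rpow {α : ℝ} (hα : -1 < α) :
    Tendsto (fun n : ℕ => (n : ℝ)⁻¹ * ∑ m ∈ Finset.range n, ((m : ℝ) / n) ^ α) atTop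
      (𝓝 (α + 1)⁻¹) := by
  have hβ : 0 < α + 1 := by linarith
  have hs : ∀ n : ℕ, ∑ m ∈ Finset.range n, (((m + 1 : ℕ) : ℝ) ^ (α + 1) - (m : ℝ) ^ (α + 1)) =
      (n : ℝ) ^ (α + 1) := fun n => by
    rw [Finset.sum_range_sub (fun m : ℕ => (m : ℝ) ^ (α + 1))]
    simp [Real.zero_rpow hβ.ne']
  have hpos : ∀ m : ℕ, 0 < ((m + 1 : ℕ) : ℝ) ^ (α + 1) - (m : ℝ) ^ (α + 1) := fun m =>
    sub_pos.2 (Real.rpow_lt_rpow (by positivity) (by push_cast; linarith) hβ)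
  have hT : Tendsto (fun n : ℕ => ∑ m ∈ Finset.range n,
      (((m + 1 : ℕ) : ℝ) ^ (α + 1) - (m : ℝ) ^ (α + 1))) atTop atTop := by
    simp_rw [hs]
    exact (tendsto_rpow_atTop hβ).comp tendsto_natCast_atTop_atTop
  refine (tendsto_sum_div_sum_of_tendsto (fun m => (hpos m).le) hT
    (tendsto_rpow_div_rpow_sub hβ)).congr' ?_
  filter_upwards [eventually_gt_atTop 0] with n hn
  have hn' : (0 : ℝ) < n := by exact_mod_cast hn
  rw [hs, Finset.mul_sum, Finset.sum_div]
  refine Finset.sum_congr rfl fun m _ => ?_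
  rw [div_mul_cancel₀ _ (hpos m).ne', Real.div_rpow (by positivity) hn'.le, add_sub_cancel_right,
    Real.rpow_add_one hn'.ne']
  have := Real.rpow_pos_of_pos hn' α
  field_simp

open Filter Topology in
lemma tendsto_sum_inv_sub_inv_tan {s : ℝ} (h0 : 0 < s) (h1 : s < 1) :
    Tendsto (fun K : ℕ => ∑ k ∈ Finset.range K, ((2 * (k : ℝ) + 1 - s)⁻¹ - (2 * (k : ℝ) + 1 + s)⁻¹))
      atTop (𝓝 (Real.pi / 2 * Real.tan (Real.pi * s / 2))) := by
  set x : ℝ := (1 - s) / 2 with hx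
  have hxz : (x : ℂ) ∈ Complex.integerComplement := by
    rw [Complex.mem_integerComplement_iff]
    rintro ⟨n, hn⟩
    have hn' : (n : ℝ) = x := by exact_mod_cast hn
    have a1 : (0 : ℝ) < n := by rw [hn']; linarith
    have a2 : (n : ℝ) < 1 := by rw [hn']; linarith
    norm_cast at a1 a2
    omega
  have h := tendsto_logDeriv_euler_cot_sub hxz
  have hre := (Complex.continuous_re.tendsto _).comp h
  have hcot : ((Real.pi : ℂ) * Complex.cot (Real.pi * x) - 1 / x).re =
      Real.pi * Real.tan (Real.pi * s / 2) - 1 / x := by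
    have : Real.tan (Real.pi * s / 2) = Real.cot (Real.pi * x) := by
      rw [← Real.tan_inv_eq_cot, ← Real.tan_pi_div_two_sub]
      congr 1
      rw [hx]; ring
    rw [this, ← Complex.ofReal_re (Real.pi * Real.cot (Real.pi * x) - 1 / x)]
    push_cast
    rfl
  rw [hcot] at hre
  have hlim : Tendsto (fun K : ℕ => (2 * (K : ℝ) + 1 - s)⁻¹) atTop (𝓝 0) := by
    refine tendsto_inv_atTop_zero.comp ?_
    have : Tendsto (fun K : ℕ => (1 - s) + 2 * (K : ℝ)) atTop atTop :=
      tendsto_atTop_add_const_left _ _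
        (tendsto_natCast_atTop_atTop.const_mul_atTop (by norm_num : (0 : ℝ) < 2))
    exact this.congr fun K => by ring
  have hfin := ((hre.add_const (1 / x)).sub (hlim.const_mul 2)).const_mul (1 / 2)
  have e : 1 / 2 * (Real.pi * Real.tan (Real.pi * s / 2) - 1 / x + 1 / x - 2 * 0) =
      Real.pi / 2 * Real.tan (Real.pi * s / 2) := by ring
  rw [e] at hfin
  refine hfin.congr fun K => ?_
  have hterm : ∀ j : ℕ, (cotTerm (x : ℂ) j).re =
      2 * (2 * ((j + 1 : ℕ) : ℝ) + 1 - s)⁻¹ - 2 * (2 * (j : ℝ) + 1 + s)⁻¹ := fun j => by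
    have : cotTerm (x : ℂ) j = ((1 / (x - (j + 1)) + 1 / (x + (j + 1)) : ℝ) : ℂ) := by
      simp [cotTerm]
    rw [this, Complex.ofReal_re, hx]
    have hj : (0 : ℝ) ≤ j := by positivity
    have b1 : (1 - s) / 2 - ((j : ℝ) + 1) ≠ 0 := by intro hh; linarith
    have b2 : (1 - s) / 2 + ((j : ℝ) + 1) ≠ 0 := by intro hh; linarith
    have b3 : 2 * ((j : ℝ) + 1) + 1 - s ≠ 0 := by intro hh; linarith
    have b4 : 2 * (j : ℝ) + 1 + s ≠ 0 := by intro hh; linarith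
    push_cast
    have c1 : (1 - s) / 2 - ((j : ℝ) + 1) = -(2 * (j : ℝ) + 1 + s) / 2 := by ring
    have c2 : (1 - s) / 2 + ((j : ℝ) + 1) = (2 * ((j : ℝ) + 1) + 1 - s) / 2 := by ring
    rw [c1, c2]
    field_simp
    ring
  simp only [Function.comp, Complex.re_sum]
  induction K with
  | zero =>
    have b : 1 - s ≠ 0 := by linarith
    simp [hx]
    field_simp
    ring
  | succ K ih =>
    rw [Finset.sum_range_succ, Finset.sum_range_succ, ← ih, hterm]
    ring

lemma sum_range_sum_range_eq_sum_lower {M : Type*} [AddCommMonoid M] (F : ℕ → ℕ → M) (N : ℕ) :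
    ∑ n ∈ Finset.range N, ∑ m ∈ Finset.range N, F n m =
      ∑ n ∈ Finset.range N, (∑ m ∈ Finset.range n, (F n m + F m n) + F n n) := by
  induction N with
  | zero => simp
  | succ N ih =>
    rw [Finset.sum_range_succ (fun n => _ + F n n), ← ih, Finset.sum_range_succ,
      Finset.sum_congr rfl fun n _ => Finset.sum_range_succ (F n) N, Finset.sum_range_succ (F N),
      Finset.sum_add_distrib, Finset.sum_add_distrib]
    abel

lemma sum_Icc_neg_eq_sum_range {M : Type*} [AddCommMonoid M] {f : ℤ → M} (hf : f 0 = 0) (N : ℕ) :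
    ∑ n ∈ Finset.Icc (-(N : ℤ)) N, f n = ∑ n ∈ Finset.range (N + 1), (f n + f (-n)) := by
  induction N with
  | zero => simp [hf]
  | succ N ih =>
    rw [Finset.sum_range_succ, ← ih]
    have : Finset.Icc (-((N + 1 : ℕ) : ℤ)) (N + 1 : ℕ) =
        insert ((N + 1 : ℕ) : ℤ) (insert (-((N + 1 : ℕ) : ℤ)) (Finset.Icc (-(N : ℤ)) N)) := by
      ext x
      simp only [Finset.mem_Icc, Finset.mem_insert]
      push_cast
      omega
    rw [this, Finset.sum_insert, Finset.sum_insert, ← add_assoc, add_comm]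
    · simp
    · simp only [Finset.mem_insert, Finset.mem_Icc]
      push_cast
      omega

/-- The kernel `1 / (n - m) + 1 / (n + m)` tested against `n ^ (s - 1)` and `m ^ (-s)`. -/
def hilbertPairing (s : ℝ) (n m : ℕ) : ℝ :=
  (n : ℝ) ^ (s - 1) * (m : ℝ) ^ (-s) * (((n : ℝ) - m)⁻¹ + ((n : ℝ) + m)⁻¹)

lemma le_hilbertPairing_add {s : ℝ} (h0 : 0 < s) (h1 : s < 1) (K : ℕ) {n m : ℕ} (h : m < n) :
    2 * (n : ℝ)⁻¹ * (n : ℝ)⁻¹ * ∑ k ∈ Finset.range K,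
      (((m : ℝ) / n) ^ (2 * (k : ℝ) - s) - ((m : ℝ) / n) ^ (2 * (k : ℝ) + s)) ≤
      hilbertPairing s n m + hilbertPairing s m n := by
  rcases Nat.eq_zero_or_pos m with rfl | hm
  · have hs : ∀ k : ℕ, 2 * (k : ℝ) - s ≠ 0 := fun k hk => by
      have e : 2 * (k : ℝ) = s := by linarith
      have a1 : (0 : ℝ) < ((2 * k : ℕ) : ℝ) := by push_cast; linarith
      have a2 : ((2 * k : ℕ) : ℝ) < ((1 : ℕ) : ℝ) := by push_cast; linarith
      rw [Nat.cast_lt] at a2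
      rw [Nat.cast_pos] at a1
      omega
    have hs' : ∀ k : ℕ, 2 * (k : ℝ) + s ≠ 0 := fun k => by positivity
    simp [hilbertPairing, Real.zero_rpow, hs, hs', (by linarith : s - 1 ≠ 0), h0.ne']
  have hm' : (0 : ℝ) < m := by exact_mod_cast hm
  have hmn : (m : ℝ) < n := by exact_mod_cast h
  have hn' : (0 : ℝ) < n := hm'.trans hmn
  set x : ℝ := (m : ℝ) / n with hx
  have hx0 : 0 < x := by positivity
  have hx1 : x < 1 := (div_lt_one hn').2 hmn
  have hmx : (m : ℝ) = n * x := by rw [hx]; field_simp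
  have hd : 0 < 1 - x ^ 2 := by nlinarith
  have hxs : 0 < x ^ s := Real.rpow_pos_of_pos hx0 _
  have hns : 0 < (n : ℝ) ^ s := Real.rpow_pos_of_pos hn' _
  have hx2 : 0 ≤ x ^ (-s) - x ^ s :=
    sub_nonneg.2 (Real.rpow_le_rpow_of_exponent_ge hx0 hx1.le (by linarith))
  have hR : hilbertPairing s n m + hilbertPairing s m n =
      2 * (n : ℝ)⁻¹ * (n : ℝ)⁻¹ * ((x ^ (-s) - x ^ s) * (1 - x ^ 2)⁻¹) := by
    have e1 : (1 - x) ≠ 0 := by linarith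
    have e2 : (1 + x) ≠ 0 := by linarith
    have e3 : (1 - x ^ 2) = (1 - x) * (1 + x) := by ring
    have k1 : ((n : ℝ) - m)⁻¹ = (n : ℝ)⁻¹ * (1 - x)⁻¹ := by rw [hmx, ← mul_inv]; ring_nf
    have k2 : ((n : ℝ) + m)⁻¹ = (n : ℝ)⁻¹ * (1 + x)⁻¹ := by rw [hmx, ← mul_inv]; ring_nf
    have k3 : ((m : ℝ) - n)⁻¹ = -((n : ℝ)⁻¹ * (1 - x)⁻¹) := by rw [← k1, ← inv_neg, neg_sub]
    have k4 : ((m : ℝ) + n)⁻¹ = (n : ℝ)⁻¹ * (1 + x)⁻¹ := by rw [← k2, add_comm]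
    simp only [hilbertPairing, k1, k2, k3, k4]
    rw [hmx, Real.mul_rpow hn'.le hx0.le, Real.mul_rpow hn'.le hx0.le, Real.rpow_sub_one hn'.ne',
      Real.rpow_sub_one hx0.ne', Real.rpow_neg hn'.le, Real.rpow_neg hx0.le, e3]
    field_simp
    ring
  have hL : ∑ k ∈ Finset.range K, (x ^ (2 * (k : ℝ) - s) - x ^ (2 * (k : ℝ) + s)) =
      (x ^ (-s) - x ^ s) * ∑ k ∈ Finset.range K, (x ^ 2) ^ k := by
    rw [Finset.mul_sum]
    refine Finset.sum_congr rfl fun k _ => ?_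
    rw [sub_eq_add_neg (2 * (k : ℝ)), Real.rpow_add hx0, Real.rpow_add hx0, ← pow_mul,
      ← Real.rpow_natCast x (2 * k)]
    push_cast
    ring
  rw [hR, hL]
  refine mul_le_mul_of_nonneg_left (mul_le_mul_of_nonneg_left ?_ hx2) (by positivity)
  rw [← one_div, le_div_iff₀ hd]
  have := geom_sum_mul_neg (x ^ 2) K
  rw [this]
  have : 0 ≤ (x ^ 2) ^ K := by positivity
  linarith

lemma le_sum_hilbertPairing {s : ℝ} (h0 : 0 < s) (h1 : s < 1) (K N : ℕ) :
    2 * ∑ n ∈ Finset.range N, ((n : ℝ)⁻¹ * ∑ m ∈ Finset.range n, ∑ k ∈ Finset.range K,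
      (((m : ℝ) / n) ^ (2 * (k : ℝ) - s) - ((m : ℝ) / n) ^ (2 * (k : ℝ) + s))) * (n : ℝ)⁻¹ ≤
      ∑ n ∈ Finset.range N, ∑ m ∈ Finset.range N, hilbertPairing s n m := by
  rw [sum_range_sum_range_eq_sum_lower, Finset.mul_sum]
  refine Finset.sum_le_sum fun n _ => ?_
  have hd : 0 ≤ hilbertPairing s n n := by
    simp only [hilbertPairing, sub_self, inv_zero, zero_add]
    positivity
  have := Finset.sum_le_sum fun m (hm : m ∈ Finset.range n) =>
    le_hilbertPairing_add h0 h1 K (Finset.mem_range.1 hm)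
  rw [← Finset.mul_sum] at this
  calc _ = _ := by ring
    _ ≤ _ := this
    _ ≤ _ := le_add_of_nonneg_right hd

open Filter Topology in
lemma tendsto_sum_range_inv : Tendsto (fun N => ∑ n ∈ Finset.range N, (n : ℝ)⁻¹) atTop atTop := by
  refine (not_summable_iff_tendsto_nat_atTop_of_nonneg fun n => by positivity).1 ?_
  exact Real.not_summable_natCast_inv

open Filter Topology in
lemma tan_le_of_sum_hilbertPairing_le {s D : ℝ} (h0 : 0 < s) (h1 : s < 1)
    (h : ∀ N : ℕ, ∑ n ∈ Finset.range (N + 1), ∑ m ∈ Finset.range (N + 1), hilbertPairing s n m ≤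
      Real.pi * D * ∑ n ∈ Finset.range (N + 1), (n : ℝ)⁻¹) :
    Real.tan (Real.pi * s / 2) ≤ D := by
  have hI : Real.pi / 2 * Real.tan (Real.pi * s / 2) ≤ Real.pi / 2 * D := by
    refine le_of_tendsto' (tendsto_sum_inv_sub_inv_tan h0 h1) fun K => ?_
    have hu : Tendsto (fun n : ℕ => (n : ℝ)⁻¹ * ∑ m ∈ Finset.range n, ∑ k ∈ Finset.range K,
        (((m : ℝ) / n) ^ (2 * (k : ℝ) - s) - ((m : ℝ) / n) ^ (2 * (k : ℝ) + s))) atTop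
        (𝓝 (∑ k ∈ Finset.range K, ((2 * (k : ℝ) + 1 - s)⁻¹ - (2 * (k : ℝ) + 1 + s)⁻¹))) := by
      have : Tendsto (fun n : ℕ => ∑ k ∈ Finset.range K,
          ((n : ℝ)⁻¹ * ∑ m ∈ Finset.range n, ((m : ℝ) / n) ^ (2 * (k : ℝ) - s) -
            (n : ℝ)⁻¹ * ∑ m ∈ Finset.range n, ((m : ℝ) / n) ^ (2 * (k : ℝ) + s))) atTop
          (𝓝 (∑ k ∈ Finset.range K, ((2 * (k : ℝ) - s + 1)⁻¹ - (2 * (k : ℝ) + s + 1)⁻¹))) :=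
        tendsto_finsetSum _ fun k _ => by
          have hk : (0 : ℝ) ≤ k := by positivity
          exact (tendsto_riemannSum_rpow (by linarith)).sub (tendsto_riemannSum_rpow (by linarith))
      convert this using 2
      · rw [Finset.sum_comm, Finset.mul_sum]
        refine Finset.sum_congr rfl fun k _ => ?_
        rw [Finset.sum_sub_distrib, mul_sub]
      · refine Finset.sum_congr rfl fun k _ => ?_
        congr 2 <;> ring
    have hlim := tendsto_sum_div_sum_of_tendsto (fun n : ℕ => by positivity) tendsto_sum_range_inv hu
    rw [← tendsto_add_atTop_iff_nat 1] at hlim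
    refine le_of_tendsto hlim ?_
    filter_upwards [(tendsto_add_atTop_iff_nat 1).2 tendsto_sum_range_inv |>.eventually_gt_atTop 0]
      with N hN
    rw [div_le_iff₀ hN]
    have := (le_sum_hilbertPairing h0 h1 K (N + 1)).trans (h N)
    linarith
  exact le_of_mul_le_mul_left hI (by positivity)

lemma abs_bilinear_hilbert_le {p q C : ℝ} (hpq : p.HolderConjugate q) (hC : 0 ≤ C)
    (h : ∀ a, MemLpZ p a → lpNorm p (H0T a) ≤ C * lpNorm p a) (S : Finset ℤ) (f g : ℤ → ℝ) :
    |∑ i ∈ S, ∑ j ∈ S, g i * f j * ((i : ℝ) - j)⁻¹| ≤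
      Real.pi * C * ((∑ j ∈ S, |f j| ^ p) ^ (1 / p) * (∑ i ∈ S, |g i| ^ q) ^ (1 / q)) := by
  have hp := hpq.lt
  have hp0 : 0 < p := by linarith
  set a : ℤ → ℂ := fun j => if j ∈ S then (f j : ℂ) else 0 with ha_def
  have ha_norm : ∀ j, ‖a j‖ ^ p = if j ∈ S then |f j| ^ p else 0 := fun j => by
    by_cases hj : j ∈ S <;> simp [ha_def, hj, Real.zero_rpow hp0.ne']
  have ha : MemLpZ p a := summable_of_hasFiniteSupport (S.finite_toSet.subset fun j hj => by
    by_contra hjS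
    exact hj ((ha_norm j).trans (if_neg hjS)))
  have hasum : ∑' j, ‖a j‖ ^ p = ∑ j ∈ S, |f j| ^ p := by
    rw [tsum_eq_sum (s := S) fun j hj => by rw [ha_norm, if_neg hj]]
    exact Finset.sum_congr rfl fun j hj => by rw [ha_norm, if_pos hj]
  have hH : ∀ i, H0T a i = ((∑ j ∈ S, f j * (Real.pi * ((i : ℝ) - j))⁻¹ : ℝ) : ℂ) := fun i => by
    refine (hasSum_H0T hp ha i).unique ?_
    rw [Complex.ofReal_sum, Finset.sum_congr rfl fun j hj =>
      show ((f j * (Real.pi * ((i : ℝ) - j))⁻¹ : ℝ) : ℂ) =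
        a j * (((Real.pi * ((i - j : ℤ) : ℝ))⁻¹ : ℝ) : ℂ) by simp [ha_def, hj]]
    exact hasSum_sum_of_ne_finset_zero fun j hj => by simp [ha_def, hj]
  have hb : ∑ i ∈ S, |∑ j ∈ S, f j * (Real.pi * ((i : ℝ) - j))⁻¹| ^ p ≤
      C ^ p * ∑ j ∈ S, |f j| ^ p := by
    rw [← hasum]
    refine le_trans ?_ ((lpNorm_le_mul_iff hp0 hC _ _).1 (h a ha))
    refine le_trans (le_of_eq ?_)
      ((ha.H0T hp).sum_le_tsum S fun i _ => Real.rpow_nonneg (norm_nonneg _) _)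
    exact Finset.sum_congr rfl fun i _ => by rw [hH, Complex.norm_real, Real.norm_eq_abs]
  have hrw : ∑ i ∈ S, ∑ j ∈ S, g i * f j * ((i : ℝ) - j)⁻¹ =
      Real.pi * ∑ i ∈ S, (∑ j ∈ S, f j * (Real.pi * ((i : ℝ) - j))⁻¹) * g i := by
    simp only [Finset.mul_sum, Finset.sum_mul]
    refine Finset.sum_congr rfl fun i _ => Finset.sum_congr rfl fun j _ => ?_
    rw [mul_inv]
    have := Real.pi_ne_zero
    field_simp
  have hF : 0 ≤ ∑ j ∈ S, |f j| ^ p := Finset.sum_nonneg fun _ _ => Real.rpow_nonneg (abs_nonneg _) _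
  have hG : 0 ≤ ∑ j ∈ S, |g j| ^ q := Finset.sum_nonneg fun _ _ => Real.rpow_nonneg (abs_nonneg _) _
  rw [hrw, abs_mul, abs_of_pos Real.pi_pos, mul_assoc]
  refine mul_le_mul_of_nonneg_left ?_ Real.pi_pos.le
  calc |∑ i ∈ S, (∑ j ∈ S, f j * (Real.pi * ((i : ℝ) - j))⁻¹) * g i|
      ≤ ∑ i ∈ S, |∑ j ∈ S, f j * (Real.pi * ((i : ℝ) - j))⁻¹| * |g i| := by
        simpa only [abs_mul] using Finset.abs_sum_le_sum_abs
          (fun i : ℤ => (∑ j ∈ S, f j * (Real.pi * ((i : ℝ) - j))⁻¹) * g i) S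
    _ ≤ _ := Real.inner_le_Lp_mul_Lq S _ _ hpq
    _ ≤ (C ^ p * ∑ j ∈ S, |f j| ^ p) ^ (1 / p) * (∑ i ∈ S, |g i| ^ q) ^ (1 / q) := by
        simp only [abs_abs]
        refine mul_le_mul_of_nonneg_right (Real.rpow_le_rpow ?_ hb (by positivity))
          (Real.rpow_nonneg hG _)
        exact Finset.sum_nonneg fun _ _ => Real.rpow_nonneg (abs_nonneg _) _
    _ = _ := by
        rw [Real.mul_rpow (Real.rpow_nonneg hC _) hF, one_div p, Real.rpow_rpow_inv hC hp0.ne',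
          mul_assoc]

/-- The odd extension of a power. -/
def oddPow (r : ℝ) (n : ℤ) : ℝ := (n.sign : ℝ) * |(n : ℝ)| ^ r

lemma sum_bilinear_oddPow {s : ℝ} (h0 : 0 < s) (N : ℕ) :
    ∑ n ∈ Finset.Icc (-(N : ℤ)) N, ∑ m ∈ Finset.Icc (-(N : ℤ)) N,
      oddPow (s - 1) n * |(m : ℝ)| ^ (-s) * ((n : ℝ) - m)⁻¹ =
    2 * ∑ n ∈ Finset.range (N + 1), ∑ m ∈ Finset.range (N + 1), hilbertPairing s n m := by
  rw [sum_Icc_neg_eq_sum_range (by simp [oddPow]), Finset.mul_sum]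
  refine Finset.sum_congr rfl fun n _ => ?_
  have hz : ∀ n : ℤ, oddPow (s - 1) n * |((0 : ℤ) : ℝ)| ^ (-s) * ((n : ℝ) - (0 : ℤ))⁻¹ = 0 :=
    fun n => by simp [Real.zero_rpow (neg_ne_zero.2 h0.ne')]
  rw [sum_Icc_neg_eq_sum_range (hz _), sum_Icc_neg_eq_sum_range (hz _), ← Finset.sum_add_distrib,
    Finset.mul_sum]
  refine Finset.sum_congr rfl fun m _ => ?_
  rcases Nat.eq_zero_or_pos n with rfl | hn
  · rcases Nat.eq_zero_or_pos m with rfl | hm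
    · simp [oddPow, hilbertPairing]
    · simp [oddPow, hilbertPairing]
  have hs : ((n : ℤ).sign : ℝ) = 1 := by
    rw [Int.sign_eq_one_of_pos (by exact_mod_cast hn), Int.cast_one]
  have e1 : (-(n : ℝ) - m)⁻¹ = -((n : ℝ) + m)⁻¹ := by rw [← inv_neg]; ring_nf
  have e2 : (-(n : ℝ) + m)⁻¹ = -((n : ℝ) - m)⁻¹ := by rw [← inv_neg]; ring_nf
  simp only [oddPow, hilbertPairing, Int.sign_neg, Int.cast_neg, hs, Int.cast_natCast, abs_neg,
    Nat.abs_cast, sub_neg_eq_add, e1, e2]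
  ring

lemma sum_abs_rpow_neg_inv {r : ℝ} (hr : 0 < r) (N : ℕ) :
    ∑ n ∈ Finset.Icc (-(N : ℤ)) N, |(|(n : ℝ)| ^ (-r⁻¹))| ^ r =
      2 * ∑ n ∈ Finset.range (N + 1), (n : ℝ)⁻¹ := by
  have : ∀ n : ℤ, |(|(n : ℝ)| ^ (-r⁻¹))| ^ r = |(n : ℝ)|⁻¹ := fun n => by
    rw [abs_of_nonneg (Real.rpow_nonneg (abs_nonneg _) _), ← Real.rpow_mul (abs_nonneg _),
      neg_mul, inv_mul_cancel₀ hr.ne', Real.rpow_neg_one]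
  simp only [this]
  rw [sum_Icc_neg_eq_sum_range (by simp), Finset.mul_sum]
  refine Finset.sum_congr rfl fun n _ => ?_
  simp
  ring

lemma abs_oddPow {r : ℝ} (hr : r ≠ 0) (n : ℤ) : |oddPow r n| = |(|(n : ℝ)| ^ r)| := by
  rcases eq_or_ne n 0 with rfl | hn
  · simp [oddPow, Real.zero_rpow hr]
  · rcases Int.sign_trichotomy n with h | h | h
    · simp [oddPow, h]
    · exact absurd (Int.sign_eq_zero_iff_zero.1 h) hn
    · simp [oddPow, h]

lemma Cconst_le_of_H0T_bound {p C : ℝ} (hp : 1 < p) (hC : 0 ≤ C)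
    (h : ∀ a, MemLpZ p a → lpNorm p (H0T a) ≤ C * lpNorm p a) : Cconst p ≤ C := by
  have hpq := Real.HolderConjugate.conjExponent hp
  set q := p.conjExponent with hq
  have hp0 : 0 < p := by linarith
  have hq0 : 0 < q := hpq.symm.pos
  have hsum : p⁻¹ + q⁻¹ = 1 := hpq.inv_add_inv_eq_one
  have hpi : 0 < p⁻¹ := inv_pos.2 hp0
  have hqi : 0 < q⁻¹ := inv_pos.2 hq0
  have hroot : ∀ x : ℝ, 0 ≤ x → x ^ (1 / p) * x ^ (1 / q) = x := fun x hx => by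
    rw [one_div, one_div, ← Real.rpow_add_of_nonneg hx hpi.le hqi.le, hsum, Real.rpow_one]
  have hN : ∀ N : ℕ, 0 ≤ 2 * ∑ n ∈ Finset.range (N + 1), (n : ℝ)⁻¹ := fun N =>
    mul_nonneg zero_le_two (Finset.sum_nonneg fun n _ => by positivity)
  rcases le_total p 2 with hp2 | hp2
  · have key : Real.tan (Real.pi * p⁻¹ / 2) ≤ C := by
      refine tan_le_of_sum_hilbertPairing_le hpi (by linarith) fun N => ?_
      have hb := (le_abs_self _).trans (abs_bilinear_hilbert_le hpq hC h (Finset.Icc (-(N : ℤ)) N)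
        (fun m => |(m : ℝ)| ^ (-p⁻¹)) (oddPow (p⁻¹ - 1)))
      have e : p⁻¹ - 1 = -q⁻¹ := by linarith
      rw [sum_bilinear_oddPow hpi, e] at hb
      simp only [abs_oddPow (neg_ne_zero.2 hqi.ne')] at hb
      rw [sum_abs_rpow_neg_inv hp0, sum_abs_rpow_neg_inv hq0, hroot _ (hN N)] at hb
      linarith
    rw [Cconst_of_le_two hp hp2]
    convert key using 2
    field_simp
  · have hq1 : 1 < q := hpq.symm.lt
    have key : Real.tan (Real.pi * q⁻¹ / 2) ≤ C := by
      refine tan_le_of_sum_hilbertPairing_le hqi (by linarith) fun N => ?_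
      have hb := (neg_abs_le _).trans' (neg_le_neg (abs_bilinear_hilbert_le hpq hC h
        (Finset.Icc (-(N : ℤ)) N) (oddPow (q⁻¹ - 1)) (fun m => |(m : ℝ)| ^ (-q⁻¹))))
      have e : q⁻¹ - 1 = -p⁻¹ := by linarith
      have hswap : ∑ i ∈ Finset.Icc (-(N : ℤ)) N, ∑ j ∈ Finset.Icc (-(N : ℤ)) N,
          |(i : ℝ)| ^ (-q⁻¹) * oddPow (q⁻¹ - 1) j * ((i : ℝ) - j)⁻¹ =
          -(2 * ∑ n ∈ Finset.range (N + 1), ∑ m ∈ Finset.range (N + 1),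
            hilbertPairing q⁻¹ n m) := by
        rw [← sum_bilinear_oddPow hqi, Finset.sum_comm, ← Finset.sum_neg_distrib]
        refine Finset.sum_congr rfl fun n _ => ?_
        rw [← Finset.sum_neg_distrib]
        refine Finset.sum_congr rfl fun m _ => ?_
        rw [← neg_sub (n : ℝ), inv_neg]
        ring
      rw [hswap, e] at hb
      simp only [abs_oddPow (neg_ne_zero.2 hpi.ne')] at hb
      rw [sum_abs_rpow_neg_inv hp0, sum_abs_rpow_neg_inv hq0, hroot _ (hN N)] at hb
      linarith
    have hq2 : q ≤ 2 := by
      rw [hq, Real.conjExponent, div_le_iff₀ (by linarith)]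
      linarith
    rw [← Cconst_conj hp, ← Real.conjExponent, ← hq, Cconst_of_le_two hq1 hq2]
    convert key using 2
    field_simp

/-- ‖𝓗‖_p ≤ ‖𝓚‖_p, and cot(π/(2p*)) = ‖𝓗₀‖_p = ‖𝓗‖_p ≤ ‖𝓡‖_p = ‖𝓚‖_p. -/
theorem norm_chain (p : ℝ) (hp : 1 < p) :
    opNormOn p HT ≤ opNormOn p KT ∧
    Real.cot (Real.pi / (2 * pstar p)) = opNormOn p H0T ∧
    opNormOn p H0T = opNormOn p HT ∧
    opNormOn p HT ≤ opNormOn p RT ∧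
    opNormOn p RT = opNormOn p KT := by
  have hC0 := Cconst_nonneg hp
  have hH : opNormOn p H0T = opNormOn p HT := by
    unfold opNormOn
    congr 1
    ext C
    exact and_congr_right fun hC => (HT_bound_iff hp hC).symm
  have hR : opNormOn p RT = opNormOn p KT := by
    unfold opNormOn
    congr 1
    ext C
    exact and_congr_right fun hC => (KT_bound_iff hp hC).symm
  have h0 : opNormOn p H0T = Cconst p :=
    IsLeast.csInf_eq ⟨⟨hC0, fun a ha => lpNorm_H0T_le hp ha⟩,
      fun C hC => Cconst_le_of_H0T_bound hp hC.1 hC.2⟩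
  have hK : opNormOn p HT ≤ opNormOn p KT := by
    rw [← hH, h0]
    refine le_csInf ⟨3 * Cconst p, by positivity, fun a ha => lpNorm_KT_le hp ha⟩ ?_
    rintro C ⟨hC, hCa⟩
    have := Cconst_le_of_H0T_bound hp (by positivity) fun a ha => lpNorm_H0T_le_of_KT hp hCa ha
    linarith
  exact ⟨hK, h0.symm, hH, hR ▸ hK, hR⟩

end
end

section
/- The operator norm of 𝓚 on ℓ²(ℤ) equals 1, and the operator norm of 𝓗 on ℓ²(ℤ) equals 1. -/
open scoped BigOperators
open MeasureTheory

noncomputable section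

open AddCircle in
/-- The product of a bounded measurable function and an `L²` function is in `L²`. -/
lemma memLp_bounded_mul {φ f : UnitAddCircle → ℂ} (hφ : Measurable φ) (hb : ∀ x, ‖φ x‖ ≤ 1)
    (hf : MemLp f 2 haarAddCircle) : MemLp (fun x => φ x * f x) 2 haarAddCircle := by
  refine hf.of_le (hφ.aestronglyMeasurable.mul hf.1) (Filter.Eventually.of_forall fun x => ?_)
  rw [norm_mul]
  exact mul_le_of_le_one_left (norm_nonneg _) (hb x)

open AddCircle in
/-- The Fourier coefficients of a product are the convolution of the Fourier coefficients. -/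
lemma hasSum_fourierCoeff_mul {φ : UnitAddCircle → ℂ} (hφ : Measurable φ)
    (hb : ∀ x, ‖φ x‖ ≤ 1) (f : Lp ℂ 2 (haarAddCircle (T := (1 : ℝ)))) (n : ℤ) :
    HasSum (fun m => fourierCoeff φ m * fourierCoeff f (n - m))
      (fourierCoeff (fun x => φ x * f x) n) := by
  have hu : MemLp (fun x => (starRingEnd ℂ) (φ x) * fourier n x) 2
      (haarAddCircle (T := (1 : ℝ))) := by
    refine memLp_bounded_mul (by fun_prop) (by simpa using hb) ?_
    exact (Lp.memLp (fourierLp 2 n)).ae_eq (coeFn_fourierLp 2 n)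
  have key := (fourierBasis (T := (1 : ℝ))).hasSum_inner_mul_inner (hu.toLp _) f
  rw [← (Equiv.subLeft n).hasSum_iff] at key
  convert! key using 1
  · ext m
    simp only [Function.comp_apply, Equiv.subLeft_apply]
    rw [← HilbertBasis.repr_apply_apply, fourierBasis_repr, L2.inner_def, fourierCoeff]
    congr 1
    apply integral_congr_ae
    rw [coe_fourierBasis]
    filter_upwards [hu.coeFn_toLp, coeFn_fourierLp 2 (n - m)] with x h1 h2
    rw [h1, h2]
    have : (fourier (-m) x : ℂ) = fourier (n - m) x * fourier (-n) x := by
      rw [← fourier_add]; congr 2; ring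
    rw [this]
    simp only [RCLike.inner_apply, smul_eq_mul, map_mul, Complex.conj_conj, fourier_neg]
    ring
  · rw [L2.inner_def, fourierCoeff]
    apply integral_congr_ae
    filter_upwards [hu.coeFn_toLp] with x h1
    rw [h1]
    simp only [RCLike.inner_apply, smul_eq_mul, map_mul, Complex.conj_conj, fourier_neg]
    ring

open AddCircle in
/-- Parseval's identity in terms of `lpNorm`. -/
lemma lpNorm_fourierCoeff (f : Lp ℂ 2 (haarAddCircle (T := (1 : ℝ)))) :
    lpNorm 2 (fourierCoeff f) = ‖f‖ := by
  rw [← fourierBasis.repr.norm_map f, lp.norm_eq_tsum_rpow (by simp)]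
  simp [_root_.lpNorm, fourierBasis_repr]

open AddCircle in
lemma memLpZ_fourierCoeff (f : Lp ℂ 2 (haarAddCircle (T := (1 : ℝ)))) :
    MemLpZ 2 (fourierCoeff f) := by
  have := (lp.memℓp (fourierBasis.repr f)).summable (by simp)
  simpa [MemLpZ, fourierBasis_repr] using this

open AddCircle in
/-- The Riesz–Fischer theorem: square-summable sequences are Fourier coefficients. -/
lemma exists_fourierCoeff_eq {a : ℤ → ℂ} (ha : MemLpZ 2 a) :
    ∃ f : Lp ℂ 2 (haarAddCircle (T := (1 : ℝ))), fourierCoeff f = a := by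
  have h : Memℓp a 2 := memℓp_gen (by simpa [MemLpZ] using ha)
  refine ⟨fourierBasis.repr.symm ⟨a, h⟩, ?_⟩
  ext n
  rw [← fourierBasis_repr]
  simp

open AddCircle in
/-- An operator of convolution with the Fourier coefficients of a function `φ` whose essential
supremum is `1` has norm `1` on `ℓ²(ℤ)`. -/
lemma opNormOn_two_eq_one {T : (ℤ → ℂ) → ℤ → ℂ} {φ : UnitAddCircle → ℂ} (hφ : Measurable φ)
    (hb : ∀ x, ‖φ x‖ ≤ 1) (hpos : ∀ c < 1, haarAddCircle {x | c ≤ ‖φ x‖} ≠ 0)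
    (hT : ∀ a n, T a n = ∑' m, fourierCoeff φ m * a (n - m)) : opNormOn 2 T = 1 := by
  have hmul (f : Lp ℂ 2 (haarAddCircle (T := (1 : ℝ)))) : T (fourierCoeff f) =
      fourierCoeff ((memLp_bounded_mul hφ hb (Lp.memLp f)).toLp _) := by
    ext n
    rw [hT, (hasSum_fourierCoeff_mul hφ hb f n).tsum_eq]
    exact congrFun (fourierCoeff_congr_ae (MemLp.coeFn_toLp _).symm) n
  have hone : (1 : ℝ) ∈ {C : ℝ | 0 ≤ C ∧
      ∀ a : ℤ → ℂ, MemLpZ 2 a → lpNorm 2 (T a) ≤ C * lpNorm 2 a} := by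
    refine ⟨zero_le_one, fun a ha => ?_⟩
    obtain ⟨f, rfl⟩ := exists_fourierCoeff_eq ha
    rw [hmul, lpNorm_fourierCoeff, lpNorm_fourierCoeff, one_mul]
    apply Lp.norm_le_norm_of_ae_le
    filter_upwards [(memLp_bounded_mul hφ hb (Lp.memLp f)).coeFn_toLp] with x hx
    rw [hx, norm_mul]
    exact mul_le_of_le_one_left (norm_nonneg _) (hb x)
  refine le_antisymm (csInf_le ⟨0, fun C hC => hC.1⟩ hone) (le_csInf ⟨1, hone⟩ ?_)
  rintro C ⟨-, hC⟩
  refine le_of_forall_lt fun b hb1 => ?_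
  obtain ⟨c, hbc, hc1⟩ := exists_between (max_lt hb1 zero_lt_one)
  have hc0 : 0 < c := (le_max_right _ _).trans_lt hbc
  refine ((le_max_left _ _).trans_lt hbc).trans_le ?_
  have hs : MeasurableSet {x | c ≤ ‖φ x‖} := measurableSet_le measurable_const hφ.norm
  have hfin : haarAddCircle {x | c ≤ ‖φ x‖} ≠ ⊤ := measure_ne_top _ _
  set f : Lp ℂ 2 (haarAddCircle (T := (1 : ℝ))) := indicatorConstLp 2 hs hfin 1 with hf
  have hfpos : 0 < ‖f‖ := by
    rw [hf, norm_indicatorConstLp (by simp) (by simp)]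
    have : 0 < haarAddCircle.real {x | c ≤ ‖φ x‖} := ENNReal.toReal_pos (hpos c hc1) hfin
    simp only [norm_one, one_mul]
    positivity
  have h := hC _ (memLpZ_fourierCoeff f)
  rw [hmul, lpNorm_fourierCoeff, lpNorm_fourierCoeff] at h
  refine le_of_mul_le_mul_right (le_trans ?_ h) hfpos
  have hcf : ‖(c : ℂ) • f‖ = c * ‖f‖ := by
    rw [norm_smul, Complex.norm_real, Real.norm_of_nonneg hc0.le]
  rw [← hcf]
  apply Lp.norm_le_norm_of_ae_le
  filter_upwards [(memLp_bounded_mul hφ hb (Lp.memLp f)).coeFn_toLp, Lp.coeFn_smul (c : ℂ) f,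
    indicatorConstLp_coeFn (p := 2) (hs := hs) (hμs := hfin) (c := (1 : ℂ))] with x h1 h2 h3
  rw [h1, h2, Pi.smul_apply, smul_eq_mul, norm_mul, norm_mul, Complex.norm_real,
    Real.norm_of_nonneg hc0.le, hf, h3]
  by_cases hx : c ≤ ‖φ x‖
  · gcongr
  · simp [Set.indicator, hx]

/-- The sawtooth function on the circle with Fourier coefficients `1 / (π n)`. -/
def sawtooth (t : UnitAddCircle) : ℂ := -2 * Complex.I * (periodizedBernoulli 1 t : ℂ)

lemma sawtooth_coe {x : ℝ} (hx : x ∈ Set.Ico (0 : ℝ) 1) :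
    sawtooth x = -Complex.I * ((2 * x - 1 : ℝ) : ℂ) := by
  rw [sawtooth, periodizedBernoulli, AddCircle.liftIco_zero_coe_apply hx, bernoulliFun_one]
  push_cast
  ring

lemma measurable_sawtooth : Measurable sawtooth := by
  have h : Measurable (periodizedBernoulli 1) := by
    have h1 : Measurable (bernoulliFun 1) := by
      simp only [funext bernoulliFun_one]
      fun_prop
    exact (h1.comp measurable_subtype_coe).comp
      (AddCircle.measurableEquivIco 1 0).measurable
  unfold sawtooth
  fun_prop

lemma exists_coe_eq (t : UnitAddCircle) : ∃ x ∈ Set.Ico (0 : ℝ) 1, (x : UnitAddCircle) = t :=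
  ⟨AddCircle.equivIco 1 0 t, by simpa using (AddCircle.equivIco 1 0 t).2,
    AddCircle.coe_equivIco⟩

lemma norm_sawtooth_le (t : UnitAddCircle) : ‖sawtooth t‖ ≤ 1 := by
  obtain ⟨x, hx, rfl⟩ := exists_coe_eq t
  rw [sawtooth_coe hx, norm_mul, norm_neg, Complex.norm_I, one_mul, Complex.norm_real,
    Real.norm_eq_abs, abs_le]
  constructor <;> linarith [hx.1, hx.2]

lemma fourierCoeff_sawtooth (n : ℤ) : fourierCoeff sawtooth n = 1 / (Real.pi * n) := by
  have h : sawtooth = fun t => (-2 * Complex.I) *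
      (((↑) : ℝ → ℂ) ∘ periodizedBernoulli 1 : UnitAddCircle → ℂ) t := rfl
  rw [h, fourierCoeff.const_mul, fourierCoeff_bernoulli_eq one_ne_zero]
  rcases eq_or_ne n 0 with rfl | hn
  · simp
  · have : (n : ℂ) ≠ 0 := by exact_mod_cast hn
    have := Real.pi_ne_zero
    field_simp
    simp

lemma fourierCoeff_comp_add_right {T : ℝ} [Fact (0 < T)] (f : AddCircle T → ℂ)
    (h : AddCircle T) (n : ℤ) :
    fourierCoeff (fun t => f (t + h)) n = fourier n h * fourierCoeff f n := by
  simp only [fourierCoeff]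
  rw [← integral_const_mul, ← integral_add_right_eq_self (fun t => fourier n h * _) h]
  congr 1
  ext t
  have : (fourier (-n) t : ℂ) = fourier n h * fourier (-n) (t + h) := by
    simp only [fourier_apply, smul_add, AddCircle.toCircle_add, Circle.coe_mul, neg_smul,
      AddCircle.toCircle_neg]
    rw [mul_left_comm, ← Circle.coe_mul (AddCircle.toCircle (n • h))]
    simp
  rw [this, smul_eq_mul, smul_eq_mul, mul_assoc]

lemma fourier_half (n : ℤ) : fourier n ((1 / 2 : ℝ) : UnitAddCircle) = (-1 : ℂ) ^ n := by
  rw [fourier_coe_apply, ← Complex.exp_pi_mul_I, ← Complex.exp_int_mul]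
  congr 1
  push_cast
  ring

/-- The sum of the sawtooth function and `s` times its translate by half a period. -/
def sawtoothPair (s : ℂ) (t : UnitAddCircle) : ℂ :=
  sawtooth t + s * sawtooth (t + ((1 / 2 : ℝ) : UnitAddCircle))

lemma measurable_sawtoothPair (s : ℂ) : Measurable (sawtoothPair s) :=
  measurable_sawtooth.add ((measurable_sawtooth.comp (measurable_add_const _)).const_mul s)

lemma fourierCoeff_sawtoothPair (s : ℂ) (n : ℤ) :
    fourierCoeff (sawtoothPair s) n = (1 + s * (-1) ^ n) / (Real.pi * n) := by
  have h1 : Integrable sawtooth AddCircle.haarAddCircle :=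
    Integrable.of_bound measurable_sawtooth.aestronglyMeasurable 1
      (Filter.Eventually.of_forall norm_sawtooth_le)
  have h2 := (h1.comp_add_right ((1 / 2 : ℝ) : UnitAddCircle)).const_mul s
  change fourierCoeff (sawtooth + _) n = _
  rw [fourierCoeff.add h1 h2, Pi.add_apply, fourierCoeff.const_mul, fourierCoeff_comp_add_right,
    fourier_half, fourierCoeff_sawtooth]
  ring

/-- The values of `sawtoothPair` on the two halves of a period. -/
lemma sawtoothPair_coe (s : ℂ) {x : ℝ} (hx : x ∈ Set.Ico (0 : ℝ) 1) :
    sawtoothPair s x = -Complex.I * (((2 * x - 1 : ℝ) : ℂ) +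
      s * ((if x < 1 / 2 then 2 * x else 2 * x - 2 : ℝ) : ℂ)) := by
  obtain ⟨h0, h1⟩ := hx
  rw [sawtoothPair, sawtooth_coe ⟨h0, h1⟩]
  split_ifs with h
  · rw [← AddCircle.coe_add, sawtooth_coe ⟨by linarith, by linarith⟩]
    push_cast
    ring
  · have : (x : UnitAddCircle) + ((1 / 2 : ℝ) : UnitAddCircle) = ((x - 1 / 2 : ℝ) : _) := by
      rw [← AddCircle.coe_add, ← AddCircle.coe_add_period 1 (x - 1 / 2)]
      congr 1
      ring
    rw [this, sawtooth_coe ⟨by linarith, by linarith⟩]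
    push_cast
    ring

lemma norm_sawtoothPair_neg_one (t : UnitAddCircle) : ‖sawtoothPair (-1) t‖ = 1 := by
  obtain ⟨x, hx, rfl⟩ := exists_coe_eq t
  rw [sawtoothPair_coe _ hx]
  split_ifs <;> · push_cast; ring_nf; simp

lemma norm_sawtoothPair_one_coe {x : ℝ} (hx : x ∈ Set.Ico (0 : ℝ) 1) :
    ‖sawtoothPair 1 x‖ = |if x < 1 / 2 then 4 * x - 1 else 4 * x - 3| := by
  rw [sawtoothPair_coe _ hx, one_mul, norm_mul, norm_neg, Complex.norm_I, one_mul,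
    ← Complex.ofReal_add, Complex.norm_real, Real.norm_eq_abs]
  congr 1
  split_ifs <;> ring

lemma norm_sawtoothPair_one_le (t : UnitAddCircle) : ‖sawtoothPair 1 t‖ ≤ 1 := by
  obtain ⟨x, hx, rfl⟩ := exists_coe_eq t
  rw [norm_sawtoothPair_one_coe hx, abs_le]
  obtain ⟨h0, h1⟩ := hx
  split_ifs <;> constructor <;> linarith

lemma measure_le_norm_sawtoothPair_one_ne_zero {c : ℝ} (hc : c < 1) :
    AddCircle.haarAddCircle {t : UnitAddCircle | c ≤ ‖sawtoothPair 1 t‖} ≠ 0 := by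
  set δ : ℝ := min (1 / 4) ((1 - c) / 4)
  have hδ : 0 < δ := lt_min (by norm_num) (by linarith)
  have ho : IsOpen ((fun x : ℝ => (x : UnitAddCircle)) '' Set.Ioo 0 δ) :=
    QuotientAddGroup.isOpenMap_coe _ isOpen_Ioo
  have hpos := ho.measure_pos AddCircle.haarAddCircle ((Set.nonempty_Ioo.2 hδ).image _)
  refine (hpos.trans_le (measure_mono ?_)).ne'
  rintro _ ⟨x, ⟨h0, hx⟩, rfl⟩
  have h4 : x < 1 / 4 := hx.trans_le (min_le_left _ _)
  have hc4 : x < (1 - c) / 4 := hx.trans_le (min_le_right _ _)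
  rw [Set.mem_ofPred_eq, norm_sawtoothPair_one_coe ⟨h0.le, by linarith⟩, if_pos (by linarith),
    abs_of_nonpos (by linarith)]
  linarith

lemma KT_eq_tsum (a : ℤ → ℂ) (n : ℤ) :
    KT a n = ∑' m, fourierCoeff (sawtoothPair (-1)) m * a (n - m) := by
  have h : ∑' m : {m : ℤ // Odd m}, a (n - (m : ℤ)) / ((m : ℤ) : ℂ) = _ :=
    tsum_subtype {m : ℤ | Odd m} (fun m => a (n - m) / (m : ℂ))
  rw [KT, h, ← tsum_mul_left]
  congr 1
  ext m
  rw [fourierCoeff_sawtoothPair]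
  rcases Int.even_or_odd m with h | h
  · simp [h, h.neg_one_zpow]
  · rw [Set.indicator_of_mem (by exact h), h.neg_one_zpow]
    ring

lemma HT_eq_tsum (a : ℤ → ℂ) (n : ℤ) :
    HT a n = ∑' m, fourierCoeff (sawtoothPair 1) m * a (n - m) := by
  have h : ∑' m : {m : ℤ // Even m ∧ m ≠ 0}, a (n - (m : ℤ)) / ((m : ℤ) : ℂ) = _ :=
    tsum_subtype {m : ℤ | Even m ∧ m ≠ 0} (fun m => a (n - m) / (m : ℂ))
  rw [HT, h, ← tsum_mul_left]
  congr 1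
  ext m
  rw [fourierCoeff_sawtoothPair]
  rcases Int.even_or_odd m with h | h
  · rcases eq_or_ne m 0 with rfl | h0
    · simp
    · rw [Set.indicator_of_mem (by exact ⟨h, h0⟩), h.neg_one_zpow]
      ring
  · simp [Int.not_even_iff_odd.2 h, h.neg_one_zpow]

/-- The operator norms of 𝓚 and 𝓗 on ℓ²(ℤ) both equal 1. -/
theorem l2_norms : opNormOn 2 KT = 1 ∧ opNormOn 2 HT = 1 := by
  constructor
  · refine opNormOn_two_eq_one (measurable_sawtoothPair (-1))
      (fun t => (norm_sawtoothPair_neg_one t).le) (fun c hc => ?_) KT_eq_tsum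
    simp [norm_sawtoothPair_neg_one, hc.le]
  · exact opNormOn_two_eq_one (measurable_sawtoothPair 1) norm_sawtoothPair_one_le
      (fun c hc => measure_le_norm_sawtoothPair_one_ne_zero hc) HT_eq_tsum

end
end
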